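/- arXiv:1802.07112 — 3 statements merged into one kernel-verified Lean document; each statement's English description precedes it below -/
import Mathlib

section
/- Let Y_n be the number of loops of a uniform random rooted map with n edges, i.e. P(Y_n = ℓ) = y_{n,ℓ}/m(n) where y_{n,ℓ} is the coefficient of w^ℓ in y_n(1,w). Then for every integer ℓ ≥ 0, the ℓ-th moment of Y_n/n converges: lim_{n→∞} (Σ_{j≥0} j^ℓ·y_{n,j}) / (n^ℓ·m(n)) = η(0,ℓ)/2. -/
open MvPolynomial Filter

/-- The recursion for the number of rooted maps by edges, over the reals. -/
structure IsMapCount (M : ℕ → ℝ) : Prop where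
  zero : M 0 = 1
  succ : ∀ n : ℕ, M (n + 1) =
    (∑ k ∈ Finset.range (n + 1), M k * M (n - k)) + (2 * (n : ℝ) + 1) * M n

/-- The part of the self-convolution of `M` at `n` in which both indices are positive. -/
def innerConv (M : ℕ → ℝ) (n : ℕ) : ℝ :=
  ∑ i ∈ Finset.range (n - 1), M (i + 1) * M (n - 1 - i)

theorem sum_range_succ_eq_ends_add_inner (F : ℕ → ℕ → ℝ) (n : ℕ) :
    ∑ i ∈ Finset.range (n + 2), F i (n + 1 - i) =
      F 0 (n + 1) + F (n + 1) 0 + ∑ i ∈ Finset.range n, F (i + 1) (n - i) := by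
  rw [Finset.sum_range_succ, Finset.sum_range_succ']
  simp only [Nat.add_sub_add_right, Nat.sub_self, Nat.sub_zero]
  ring

namespace IsMapCount

variable {M : ℕ → ℝ}

theorem pos (h : IsMapCount M) (n : ℕ) : 0 < M n := by
  induction n using Nat.strong_induction_on with
  | _ n ih =>
    rcases n with _ | n
    · simp [h.zero]
    · rw [h.succ]
      have h1 : 0 ≤ ∑ k ∈ Finset.range (n + 1), M k * M (n - k) :=
        Finset.sum_nonneg fun k hk => by
          have := Finset.mem_range.1 hk
          exact (mul_pos (ih k (by omega)) (ih (n - k) (by omega))).le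
      have h2 := ih n (by omega)
      positivity

theorem innerConv_nonneg (h : IsMapCount M) (n : ℕ) : 0 ≤ innerConv M n :=
  Finset.sum_nonneg fun _ _ => (mul_pos (h.pos _) (h.pos _)).le

theorem conv_eq (h : IsMapCount M) (n : ℕ) :
    ∑ k ∈ Finset.range (n + 2), M k * M (n + 1 - k) =
      2 * M (n + 1) + innerConv M (n + 1) := by
  rw [sum_range_succ_eq_ends_add_inner (fun i j => M i * M j), innerConv, h.zero]
  simp only [Nat.add_sub_cancel]
  ring

theorem succ_succ (h : IsMapCount M) (n : ℕ) :
    M (n + 2) = (2 * (n : ℝ) + 5) * M (n + 1) + innerConv M (n + 1) := by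
  rw [h.succ, h.conv_eq]
  push_cast
  ring

theorem one (h : IsMapCount M) : M 1 = 2 := by
  rw [h.succ]; norm_num [h.zero]

theorem two (h : IsMapCount M) : M 2 = 10 := by
  rw [h.succ_succ]; norm_num [h.one, innerConv]

theorem mul_le_of_succ_le (h : IsMapCount M) {n : ℕ}
    (hn : ∀ k < n, M (k + 1) ≤ (2 * (k : ℝ) + 5) * M k) (i : ℕ) :
    ∀ j, i ≤ j → i + j + 4 ≤ n → M (i + 2) * M (j + 2) ≤ 10 * M (i + j + 2) := by
  induction i with
  | zero => intro j _ _; simp [h.two]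
  | succ i ih =>
    intro j hij hn'
    have h1 := hn (i + 2) (by omega)
    have h2 : (2 * (j : ℝ) + 7) * M (j + 2) ≤ M (j + 3) := by
      have h3 := h.succ_succ (j + 1)
      have h4 := h.innerConv_nonneg (j + 2)
      push_cast at h3
      rw [show j + 1 + 2 = j + 3 by ring, show j + 1 + 1 = j + 2 by ring] at h3
      nlinarith
    have h5 := ih (j + 1) (by omega) (by omega)
    have hi := h.pos (i + 2)
    have hj := h.pos (j + 2)
    have hij' : (i : ℝ) + 1 ≤ j := by exact_mod_cast hij
    push_cast at h1
    calc M (i + 1 + 2) * M (j + 2) ≤ ((2 * ((i : ℝ) + 2) + 5) * M (i + 2)) * M (j + 2) := by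
          gcongr
      _ ≤ M (i + 2) * ((2 * (j : ℝ) + 7) * M (j + 2)) := by
          have : 0 < M (i + 2) * M (j + 2) := by positivity
          nlinarith
      _ ≤ M (i + 2) * M (j + 3) := by gcongr
      _ ≤ _ := by
        rw [show i + 1 + j + 2 = i + (j + 1) + 2 by ring]
        exact h5

theorem innerConv_le (h : IsMapCount M) (n : ℕ) :
    (2 * (n : ℝ) + 1) * innerConv M n ≤ 9 * M n := by
  induction n using Nat.strong_induction_on with
  | _ n ih =>
    have hn : ∀ k < n, M (k + 1) ≤ (2 * (k : ℝ) + 5) * M k := by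
      intro k hk
      rcases k with _ | k
      · norm_num [h.one, h.zero]
      · have h1 := ih (k + 1) hk
        have h2 := h.pos (k + 1)
        have h0 := h.innerConv_nonneg (k + 1)
        rw [h.succ_succ]
        push_cast at h1 ⊢
        rcases k with _ | _ | k
        · norm_num [innerConv, h.one]
        · norm_num [innerConv, h.one, h.two, Finset.sum_range_succ]
        · push_cast at h1 ⊢
          nlinarith
    match n with
    | 0 => simp [innerConv, h.zero]
    | 1 => simp [innerConv, h.one]
    | 2 => norm_num [innerConv, h.one, h.two]
    | 3 =>
      have := h.succ_succ 1
      norm_num [innerConv, h.one, h.two, Finset.sum_range_succ] at this ⊢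
      rw [this]; norm_num
    | n + 4 =>
      have hsum : innerConv M (n + 4) ≤ 4 * M (n + 3) + 10 * (n + 1) * M (n + 2) := by
        have e : innerConv M (n + 4) = ∑ i ∈ Finset.range (n + 1 + 2),
            (fun i j => M (i + 1) * M (j + 1)) i (n + 1 + 1 - i) := by
          refine Finset.sum_congr rfl fun i hi => ?_
          have := Finset.mem_range.1 hi
          simp only
          congr 2
          omega
        rw [e, sum_range_succ_eq_ends_add_inner (fun i j => M (i + 1) * M (j + 1))]
        simp only [h.one, zero_add]
        have : ∑ i ∈ Finset.range (n + 1), M (i + 1 + 1) * M (n + 1 - i + 1) ≤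
            ∑ i ∈ Finset.range (n + 1), 10 * M (n + 2) := by
          refine Finset.sum_le_sum fun i hi => ?_
          have hi' := Finset.mem_range.1 hi
          obtain ⟨j, rfl⟩ : ∃ j, n = i + j := ⟨n - i, by omega⟩
          rw [show i + j + 1 - i + 1 = j + 2 by omega]
          rcases le_total i j with hij | hij
          · exact h.mul_le_of_succ_le hn i j hij (by omega)
          · have := h.mul_le_of_succ_le hn j i hij (by omega)
            rw [mul_comm, add_comm i j]
            exact this
        rw [Finset.sum_const, Finset.card_range, nsmul_eq_mul] at this
        push_cast at this
        simp only [Nat.add_assoc] at this ⊢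
        norm_num at this ⊢
        linarith
      have h3 := h.succ_succ (n + 2)
      have h2 := h.succ_succ (n + 1)
      have i3 := h.innerConv_nonneg (n + 3)
      have i2 := h.innerConv_nonneg (n + 2)
      have p3 := h.pos (n + 3)
      have p2 := h.pos (n + 2)
      simp only [Nat.add_assoc] at h3 h2
      norm_num at h3 h2
      push_cast
      have g3 : (2 * (n : ℝ) + 9) * M (n + 3) ≤ M (n + 4) := by linarith
      have g2 : (2 * (n : ℝ) + 7) * M (n + 2) ≤ M (n + 3) := by linarith
      have hn0 : (0 : ℝ) ≤ n := n.cast_nonneg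
      have g4 : 10 * ((n : ℝ) + 1) * M (n + 2) ≤ 5 * M (n + 3) := by nlinarith
      nlinarith

theorem tendsto_innerConv_div (h : IsMapCount M) :
    Tendsto (fun n => innerConv M n / M n) atTop (nhds 0) := by
  have h9 : Tendsto (fun n : ℕ => 9 * (1 / ((n : ℝ) + 1))) atTop (nhds 0) := by
    simpa using tendsto_one_div_add_atTop_nhds_zero_nat.const_mul (9 : ℝ)
  refine squeeze_zero (fun n => div_nonneg (h.innerConv_nonneg n) (h.pos n).le) (fun n => ?_) h9
  have h1 := h.innerConv_le n
  have h2 := h.innerConv_nonneg n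
  rw [mul_one_div, div_le_div_iff₀ (h.pos n) (by positivity)]
  have : (0 : ℝ) ≤ n * innerConv M n := by positivity
  nlinarith

theorem conv_le (h : IsMapCount M) (n : ℕ) :
    ∑ k ∈ Finset.range (n + 1), M k * M (n - k) ≤ 11 * M n := by
  rcases n with _ | n
  · norm_num [h.zero]
  · rw [h.conv_eq]
    have h1 := h.innerConv_le (n + 1)
    have h2 := h.innerConv_nonneg (n + 1)
    push_cast at h1
    have : (0 : ℝ) ≤ n * innerConv M (n + 1) := by positivity
    nlinarith

/-- The growth rate `W (n+1) / W n` of `W n = (n+1) ^ s * M n`. -/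
theorem tendsto_growth_sub (h : IsMapCount M) (s : ℕ) :
    Tendsto (fun n : ℕ => (((n : ℝ) + 2) ^ s * M (n + 1)) / (((n : ℝ) + 1) ^ s * M n) -
      2 * (n : ℝ)) atTop (nhds (2 * s + 3)) := by
  have hx : Tendsto (fun n : ℕ => 1 + 1 / ((n : ℝ) + 1)) atTop (nhds 1) := by
    simpa using tendsto_one_div_add_atTop_nhds_zero_nat.const_add (1 : ℝ)
  have hgeom : Tendsto (fun n : ℕ => ∑ i ∈ Finset.range s, (1 + 1 / ((n : ℝ) + 1)) ^ i)
      atTop (nhds s) := by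
    simpa using tendsto_finsetSum (Finset.range s) fun i _ => hx.pow i
  have h2 : Tendsto (fun n : ℕ => 2 + 1 / ((n : ℝ) + 1)) atTop (nhds 2) := by
    simpa using tendsto_one_div_add_atTop_nhds_zero_nat.const_add (2 : ℝ)
  have hmain := (h2.mul hgeom).add ((hx.pow s).mul (h.tendsto_innerConv_div)) |>.add_const 3
  simp only [one_pow, mul_zero, add_zero] at hmain
  refine hmain.congr' ?_
  filter_upwards [eventually_ge_atTop 1] with n hn
  obtain ⟨n, rfl⟩ : ∃ k, n = k + 1 := ⟨n - 1, by omega⟩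
  have hp := h.pos (n + 1)
  have hq : (0 : ℝ) < (n + 1 : ℕ) + 1 := by positivity
  have e1 := mul_geom_sum (1 + 1 / (((n + 1 : ℕ) : ℝ) + 1)) s
  have e2 : (2 + 1 / (((n + 1 : ℕ) : ℝ) + 1)) =
      (2 * ((n + 1 : ℕ) : ℝ) + 3) * (1 + 1 / (((n + 1 : ℕ) : ℝ) + 1) - 1) := by
    field_simp; ring
  have e3 : (((n + 1 : ℕ) : ℝ) + 2) ^ s =
      (1 + 1 / (((n + 1 : ℕ) : ℝ) + 1)) ^ s * (((n + 1 : ℕ) : ℝ) + 1) ^ s := by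
    rw [← mul_pow]; congr 1; field_simp; ring
  rw [e2, mul_assoc, e1, e3, h.succ_succ]
  generalize (1 + 1 / (((n + 1 : ℕ) : ℝ) + 1)) ^ s = x
  have : (((n + 1 : ℕ) : ℝ) + 1) ^ s ≠ 0 := by positivity
  field_simp
  push_cast
  ring

end IsMapCount

/-- A first-order recursion with contraction rate of harmonic size. -/
theorem tendsto_zero_of_le_contract {x ε : ℕ → ℝ} {γ : ℝ} (hγ : 0 < γ)
    (hx : ∀ n, 0 ≤ x n) (hε : Tendsto ε atTop (nhds 0)) {p : ℕ → ℝ}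
    (hp : ∀ᶠ n : ℕ in atTop, γ / ((n : ℝ) + 1) ≤ p n ∧ p n ≤ 1)
    (h : ∀ᶠ n in atTop, x (n + 1) ≤ (1 - p n) * x n + p n * ε n) :
    Tendsto x atTop (nhds 0) := by
  rw [Metric.tendsto_atTop]
  intro δ hδ
  have hε' : ∀ᶠ n in atTop, ε n ≤ δ / 2 :=
    (hε.eventually (gt_mem_nhds (half_pos hδ))).mono fun n hn => hn.le
  obtain ⟨N, hN⟩ := eventually_atTop.1 (hp.and (h.and hε'))
  set H : ℕ → ℝ := fun n => ∑ i ∈ Finset.range n, 1 / ((i : ℝ) + 1) with hH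
  have key : ∀ n, N ≤ n → x n - δ / 2 ≤ x N * Real.exp (-γ * (H n - H N)) := by
    intro n hn
    induction n, hn using Nat.le_induction with
    | base => simp; linarith
    | succ n hn ih =>
      obtain ⟨⟨h1, h2⟩, h3, h4⟩ := hN n hn
      have hp0 : 0 ≤ p n := le_trans (by positivity) h1
      have hexp : 1 - p n ≤ Real.exp (-γ * (1 / ((n : ℝ) + 1))) := by
        have := Real.add_one_le_exp (-γ * (1 / ((n : ℝ) + 1)))
        have e : γ / ((n : ℝ) + 1) = γ * (1 / ((n : ℝ) + 1)) := by ring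
        linarith
      have hs : H (n + 1) = H n + 1 / ((n : ℝ) + 1) := Finset.sum_range_succ _ _
      have e : Real.exp (-γ * (H (n + 1) - H N)) =
          Real.exp (-γ * (1 / ((n : ℝ) + 1))) * Real.exp (-γ * (H n - H N)) := by
        rw [← Real.exp_add, hs]; congr 1; ring
      calc x (n + 1) - δ / 2 ≤ (1 - p n) * (x n - δ / 2) := by nlinarith
        _ ≤ (1 - p n) * (x N * Real.exp (-γ * (H n - H N))) := by
            gcongr
        _ ≤ Real.exp (-γ * (1 / ((n : ℝ) + 1))) * (x N * Real.exp (-γ * (H n - H N))) := by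
            have := hx N
            gcongr
        _ = _ := by rw [e]; ring
  have hlim : Tendsto (fun n => x N * Real.exp (-γ * (H n - H N))) atTop (nhds 0) := by
    have hHt : Tendsto H atTop atTop := Real.tendsto_sum_range_one_div_nat_succ_atTop
    have h1 : Tendsto (fun n => -γ * (H n - H N)) atTop atBot :=
      (tendsto_atTop_add_const_right _ (-H N) hHt).const_mul_atTop_of_neg (by linarith)
    simpa using (Real.tendsto_exp_atBot.comp h1).const_mul (x N)
  obtain ⟨K, hK⟩ := eventually_atTop.1 (hlim.eventually (gt_mem_nhds (half_pos hδ)))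
  refine ⟨max N K, fun n hn => ?_⟩
  have h1 := key n (le_trans (le_max_left _ _) hn)
  have h2 := hK n (le_trans (le_max_right _ _) hn)
  rw [Real.dist_eq, sub_zero, abs_of_nonneg (hx n)]
  linarith

theorem tendsto_of_linear_recursion {a g d r : ℕ → ℝ} {c b q : ℝ} (hc : 0 < c)
    (hg : Tendsto (fun n => g n - 2 * (n : ℝ)) atTop (nhds q))
    (hd : Tendsto d atTop (nhds c)) (hr : Tendsto r atTop (nhds b))
    (h : ∀ n, g n * a (n + 1) = (g n - d n) * a n + r n) :
    Tendsto a atTop (nhds (b / c)) := by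
  have hzero : Tendsto (fun n => |a n - b / c|) atTop (nhds 0) := by
    have hε : Tendsto (fun n => |r n - d n * (b / c)| / d n) atTop (nhds 0) := by
      have := ((hr.sub (hd.mul_const (b / c))).abs).div hd hc.ne'
      rwa [mul_div_cancel₀ _ hc.ne', sub_self, abs_zero, zero_div] at this
    have hd1 := hd.eventually (lt_mem_nhds (half_lt_self hc))
    have hd2 := hd.eventually (gt_mem_nhds (show c < 2 * c by linarith))
    have hg1 := hg.eventually (gt_mem_nhds (lt_add_one q))
    have hg2 := hg.eventually (lt_mem_nhds (sub_one_lt q))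
    have hn1 := tendsto_natCast_atTop_atTop.eventually_ge_atTop (2 * c + 1 - q)
    have hn2 := tendsto_natCast_atTop_atTop.eventually_ge_atTop (q + 1)
    refine tendsto_zero_of_le_contract (γ := c / 6) (by positivity) (fun n => abs_nonneg _) hε
      (p := fun n => d n / g n) ?_ ?_
    · filter_upwards [hd1, hd2, hg1, hg2, hn1, hn2] with n h1 h2 h3 h4 h5 h6
      have hn0 : (0 : ℝ) ≤ n := n.cast_nonneg
      have hgpos : 0 < g n := by linarith
      constructor
      · rw [div_le_div_iff₀ (by positivity) hgpos]
        nlinarith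
      · rw [div_le_one hgpos]; linarith
    · filter_upwards [hd1, hd2, hg2, hn1] with n h1 h2 h4 h5
      have hn0 : (0 : ℝ) ≤ n := n.cast_nonneg
      have hgpos : 0 < g n := by linarith
      have hdpos : 0 < d n := by linarith
      have e : a (n + 1) - b / c =
          (1 - d n / g n) * (a n - b / c) + (r n - d n * (b / c)) / g n := by
        have := h n
        field_simp at this ⊢
        linear_combination c * this
      have hp1 : 0 ≤ 1 - d n / g n := by
        rw [sub_nonneg, div_le_one hgpos]; linarith
      calc |a (n + 1) - b / c| ≤ |(1 - d n / g n) * (a n - b / c)| +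
            |(r n - d n * (b / c)) / g n| := by rw [e]; exact abs_add_le _ _
        _ = _ := by
          rw [abs_mul, abs_of_nonneg hp1, abs_div, abs_of_pos hgpos]
          field_simp
  have := (tendsto_zero_iff_abs_tendsto_zero _).2 hzero
  simpa using this.add_const (b / c)

/-- The partial evaluation `v ↦ 1` (with `v = X 0`, `w = X 1`). -/
noncomputable abbrev rootForget : MvPolynomial (Fin 2) ℝ →ₐ[ℝ] MvPolynomial (Fin 2) ℝ :=
  aeval (fun j : Fin 2 => if j = 0 then (1 : MvPolynomial (Fin 2) ℝ) else X 1)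

/-- The recursion for the generating polynomials of rooted maps by root degree and loops. -/
structure IsLoopSeq (y : ℕ → MvPolynomial (Fin 2) ℝ) : Prop where
  zero : y 0 = 1
  succ : ∀ n : ℕ, y (n + 1) =
    X 0 * y n + C (2 * (n : ℝ)) * X 0 * y n +
      X 0 * ∑ i ∈ Finset.range (n + 1), rootForget (y i) * y (n - i) +
      X 0 ^ 2 * (X 0 * X 1 - 1) * pderiv (0 : Fin 2) (y n)

/-- Polynomials in `v, w` with nonnegative coefficients and degree at most `a` in `v`,
at most `b` in `w`. -/
noncomputable def nonnegCone (a b : ℕ) : AddSubmonoid (MvPolynomial (Fin 2) ℝ) :=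
  AddSubmonoid.closure {p | ∃ (c : ℝ) (i j : ℕ), 0 ≤ c ∧ i ≤ a ∧ j ≤ b ∧
    p = C c * (X 0 ^ i * X 1 ^ j)}

theorem mem_nonnegCone {a b i j : ℕ} {c : ℝ} (hc : 0 ≤ c) (hi : i ≤ a) (hj : j ≤ b) :
    C c * (X 0 ^ i * X 1 ^ j) ∈ nonnegCone a b :=
  AddSubmonoid.subset_closure ⟨c, i, j, hc, hi, hj, rfl⟩

theorem nonnegCone_map_le (f : MvPolynomial (Fin 2) ℝ →+ MvPolynomial (Fin 2) ℝ)
    {a b a' b' : ℕ}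
    (h : ∀ (c : ℝ) (i j : ℕ), 0 ≤ c → i ≤ a → j ≤ b →
      f (C c * (X 0 ^ i * X 1 ^ j)) ∈ nonnegCone a' b')
    {p : MvPolynomial (Fin 2) ℝ} (hp : p ∈ nonnegCone a b) : f p ∈ nonnegCone a' b' := by
  induction hp using AddSubmonoid.closure_induction with
  | mem x hx =>
    obtain ⟨c, i, j, hc, hi, hj, rfl⟩ := hx
    exact h c i j hc hi hj
  | zero => simp
  | add x y _ _ hx hy => rw [map_add]; exact add_mem hx hy

theorem nonnegCone_mul {a b a' b' : ℕ} {p q : MvPolynomial (Fin 2) ℝ}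
    (hp : p ∈ nonnegCone a b) (hq : q ∈ nonnegCone a' b') :
    p * q ∈ nonnegCone (a + a') (b + b') := by
  refine nonnegCone_map_le (AddMonoidHom.mulRight q) (fun c i j hc hi hj => ?_) hp
  refine nonnegCone_map_le (AddMonoidHom.mulLeft _) (fun c' i' j' hc' hi' hj' => ?_) hq
  have : (C c * (X 0 ^ i * X 1 ^ j) * (C c' * (X 0 ^ i' * X 1 ^ j')) :
      MvPolynomial (Fin 2) ℝ) = C (c * c') * (X 0 ^ (i + i') * X 1 ^ (j + j')) := by
    rw [C_mul]; ring
  simp only [AddMonoidHom.coe_mulLeft, this]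
  exact mem_nonnegCone (mul_nonneg hc hc') (by omega) (by omega)

theorem nonnegCone_mono {a b a' b' : ℕ} (ha : a ≤ a') (hb : b ≤ b') :
    nonnegCone a b ≤ nonnegCone a' b' := fun _ hp =>
  nonnegCone_map_le (AddMonoidHom.id _)
    (fun _ _ _ hc hi hj => mem_nonnegCone hc (hi.trans ha) (hj.trans hb)) hp

theorem rootForget_mem_nonnegCone {a b : ℕ} {p : MvPolynomial (Fin 2) ℝ}
    (hp : p ∈ nonnegCone a b) : rootForget p ∈ nonnegCone 0 b := by
  refine nonnegCone_map_le (rootForget : _ →+ _) (fun c i j hc hi hj => ?_) hp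
  have : rootForget (C c * (X 0 ^ i * X 1 ^ j)) = C c * (X 0 ^ 0 * X 1 ^ j) := by
    simp [algebraMap_eq]
  simp only [AddMonoidHom.coe_coe, this]
  exact mem_nonnegCone hc le_rfl hj

theorem X_zero_mem_nonnegCone : (X 0 : MvPolynomial (Fin 2) ℝ) ∈ nonnegCone 1 0 := by
  simpa using mem_nonnegCone (c := 1) (i := 1) (j := 0) zero_le_one le_rfl le_rfl

theorem insertion_mem_nonnegCone {n b : ℕ} {p : MvPolynomial (Fin 2) ℝ}
    (hp : p ∈ nonnegCone (2 * n) b) :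
    C (2 * (n : ℝ)) * X 0 * p + X 0 ^ 2 * (X 0 * X 1 - 1) * pderiv (0 : Fin 2) p ∈
      nonnegCone (2 * n + 2) (b + 1) := by
  refine nonnegCone_map_le ((AddMonoidHom.mulLeft (C (2 * (n : ℝ)) * X 0)) +
    (AddMonoidHom.mulLeft (X 0 ^ 2 * (X 0 * X 1 - 1))).comp
      (pderiv (R := ℝ) (0 : Fin 2)).toLinearMap.toAddMonoidHom)
    (fun c i j hc hi hj => ?_) hp
  have hi' : (i : ℝ) ≤ 2 * n := by exact_mod_cast hi
  have : C (2 * (n : ℝ)) * X 0 * (C c * (X 0 ^ i * X 1 ^ j)) + X 0 ^ 2 * (X 0 * X 1 - 1) *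
      pderiv (0 : Fin 2) (C c * (X 0 ^ i * X 1 ^ j)) =
      C ((2 * n - i) * c) * (X 0 ^ (i + 1) * X 1 ^ j) +
        C (i * c) * (X 0 ^ (i + 2 - if i = 0 then 1 else 0) * X 1 ^ (j + 1)) := by
    rcases i with _ | i
    · simp [pderiv_X]
      ring
    · simp [pderiv_X]
      ring
  simp only [AddMonoidHom.add_apply, AddMonoidHom.coe_mulLeft, AddMonoidHom.comp_apply]
  erw [this]
  refine add_mem (mem_nonnegCone (mul_nonneg (by linarith) hc) (by omega) (by omega))
    (mem_nonnegCone (by positivity) (by omega) (by omega))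

/-- Expansion at `v = w = 1`, as a polynomial in `v - 1` over the polynomials in `w - 1`. -/
noncomputable def jet : MvPolynomial (Fin 2) ℝ →ₐ[ℝ] Polynomial (Polynomial ℝ) :=
  aeval (fun j : Fin 2 =>
    if j = 0 then Polynomial.X + 1 else Polynomial.C (Polynomial.X + 1))

theorem jet_X_zero : jet (X 0) = Polynomial.X + 1 := by simp [jet]

theorem jet_X_one : jet (X 1) = Polynomial.C (Polynomial.X + 1) := by simp [jet]

theorem jet_C (c : ℝ) : jet (C c) = Polynomial.C (Polynomial.C c) := by
  simp [jet]

theorem jet_rootForget (p : MvPolynomial (Fin 2) ℝ) :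
    jet (rootForget p) = Polynomial.C ((jet p).coeff 0) := by
  induction p using MvPolynomial.induction_on with
  | C a => rw [algHom_C, algebraMap_eq, jet_C]; simp
  | add p q hp hq => rw [map_add, map_add, hp, hq, map_add, Polynomial.coeff_add, Polynomial.C_add]
  | mul_X p i hp =>
    rw [map_mul, map_mul, hp, map_mul, Polynomial.mul_coeff_zero, Polynomial.C_mul]
    fin_cases i
    · simp [jet_X_zero]
    · simp [jet_X_one]

theorem jet_pderiv (p : MvPolynomial (Fin 2) ℝ) :
    jet (pderiv (0 : Fin 2) p) = Polynomial.derivative (jet p) := by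
  induction p using MvPolynomial.induction_on with
  | C a => simp
  | add p q hp hq => simp [hp, hq]
  | mul_X p i hp =>
    rw [pderiv_mul, map_add, map_mul, map_mul, map_mul, Polynomial.derivative_mul, hp]
    fin_cases i
    · simp [jet_X_zero, pderiv_X]
    · simp [jet_X_one, pderiv_X]

/-- The coefficient of `(v - 1) ^ k * (w - 1) ^ l`. -/
noncomputable def jetCoeff (k l : ℕ) : MvPolynomial (Fin 2) ℝ →+ ℝ :=
  ((Polynomial.lcoeff ℝ l).toAddMonoidHom.comp
    (Polynomial.lcoeff (Polynomial ℝ) k).toAddMonoidHom).comp (jet : _ →+ _)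

theorem jetCoeff_apply (k l : ℕ) (p : MvPolynomial (Fin 2) ℝ) :
    jetCoeff k l p = ((jet p).coeff k).coeff l := rfl

theorem jetCoeff_monomial (k l i j : ℕ) (c : ℝ) :
    jetCoeff k l (C c * (X 0 ^ i * X 1 ^ j)) = c * (i.choose k * j.choose l) := by
  rw [jetCoeff_apply, map_mul, map_mul, map_pow, map_pow, jet_C, jet_X_zero, jet_X_one,
    ← Polynomial.C_pow, Polynomial.coeff_C_mul, Polynomial.coeff_mul_C,
    Polynomial.coeff_X_add_one_pow, Polynomial.coeff_C_mul, ← Polynomial.C_eq_natCast,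
    Polynomial.coeff_C_mul, Polynomial.coeff_X_add_one_pow]

theorem jetCoeff_bounds {n k l : ℕ} {p : MvPolynomial (Fin 2) ℝ}
    (hp : p ∈ nonnegCone (2 * n) n) :
    0 ≤ jetCoeff k l p ∧ jetCoeff k l p ≤ 2 ^ k * ((n : ℝ) + 1) ^ (k + l) * jetCoeff 0 0 p := by
  induction hp using AddSubmonoid.closure_induction with
  | mem x hx =>
    obtain ⟨c, i, j, hc, hi, hj, rfl⟩ := hx
    rw [jetCoeff_monomial, jetCoeff_monomial]
    refine ⟨by positivity, ?_⟩
    have h1 : (i.choose k : ℝ) ≤ (2 * ((n : ℝ) + 1)) ^ k := by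
      calc (i.choose k : ℝ) ≤ (i ^ k : ℕ) := by exact_mod_cast Nat.choose_le_pow i k
        _ ≤ _ := by
          push_cast
          have : (i : ℝ) ≤ 2 * n := by exact_mod_cast hi
          gcongr; linarith
    have h2 : (j.choose l : ℝ) ≤ ((n : ℝ) + 1) ^ l := by
      calc (j.choose l : ℝ) ≤ (j ^ l : ℕ) := by exact_mod_cast Nat.choose_le_pow j l
        _ ≤ _ := by
          push_cast
          have : (j : ℝ) ≤ n := by exact_mod_cast hj
          gcongr; linarith
    calc c * ((i.choose k : ℝ) * j.choose l)
        ≤ c * ((2 * ((n : ℝ) + 1)) ^ k * ((n : ℝ) + 1) ^ l) := by gcongr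
      _ = _ := by simp [mul_pow, pow_add]; ring
  | zero => simp
  | add x y _ _ hx hy =>
    rw [map_add, map_add]
    exact ⟨add_nonneg hx.1 hy.1, by linarith [hx.2, hy.2]⟩

/-- `u` divided by the order `(n+1) ^ s * M n`. -/
noncomputable def scaled (M : ℕ → ℝ) (s : ℕ) (u : ℕ → ℝ) (n : ℕ) : ℝ :=
  u n / (((n : ℝ) + 1) ^ s * M n)

theorem tendsto_scaled_const_zero (M : ℕ → ℝ) (s : ℕ) :
    Tendsto (scaled M s fun _ => 0) atTop (nhds 0) := by
  have : scaled M s (fun _ => 0) = fun _ => 0 := by ext; simp [scaled]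
  rw [this]
  exact tendsto_const_nhds

theorem IsMapCount.tendsto_scaled_zero {M : ℕ → ℝ} (hM : IsMapCount M) {s t : ℕ} (hst : s < t)
    {u : ℕ → ℝ} {K : ℝ}
    (hu : ∀ n, |u n| ≤ K * ((n : ℝ) + 1) ^ s * M n) :
    Tendsto (scaled M t u) atTop (nhds 0) := by
  have hK : Tendsto (fun n : ℕ => K * (1 / ((n : ℝ) + 1))) atTop (nhds 0) := by
    simpa using tendsto_one_div_add_atTop_nhds_zero_nat.const_mul K
  refine squeeze_zero_norm (fun n => ?_) hK
  have hp := hM.pos n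
  have hK0 : 0 ≤ K * (((n : ℝ) + 1) ^ s * M n) := by
    rw [← mul_assoc]; exact (abs_nonneg _).trans (hu n)
  have hK1 : 0 ≤ K := nonneg_of_mul_nonneg_left hK0 (by positivity)
  have hn : (1 : ℝ) ≤ (n : ℝ) + 1 := by linarith [(n.cast_nonneg : (0 : ℝ) ≤ n)]
  rw [scaled, Real.norm_eq_abs, abs_div, abs_of_pos (by positivity : 0 < ((n : ℝ) + 1) ^ t * M n),
    mul_one_div, div_le_div_iff₀ (by positivity) (by positivity)]
  calc |u n| * ((n : ℝ) + 1) ≤ K * ((n : ℝ) + 1) ^ s * M n * ((n : ℝ) + 1) := by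
        gcongr; exact hu n
    _ = K * (((n : ℝ) + 1) ^ (s + 1) * M n) := by ring
    _ ≤ _ := by gcongr; exact hst

/-- A moment of the number of loops weighted by binomial coefficients. -/
noncomputable def mixedMoment (p : MvPolynomial (Fin 2) ℝ) (r k : ℕ) : ℝ :=
  ∑ j ∈ Finset.range (p.totalDegree + 1),
    (j : ℝ) ^ r * j.choose k * coeff (Finsupp.single (1 : Fin 2) j) p

theorem mixedMoment_succ (p : MvPolynomial (Fin 2) ℝ) (r k : ℕ) :
    mixedMoment p (r + 1) k =
      (k + 1) * mixedMoment p r (k + 1) + k * mixedMoment p r k := by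
  rw [mixedMoment, mixedMoment, mixedMoment, Finset.mul_sum, Finset.mul_sum,
    ← Finset.sum_add_distrib]
  refine Finset.sum_congr rfl fun j _ => ?_
  have : (j : ℝ) * j.choose k = (k + 1) * j.choose (k + 1) + k * j.choose k := by
    have h1 := Nat.choose_succ_right_eq j k
    rcases le_total k j with hkj | hkj
    · have h2 : (j.choose (k + 1) : ℝ) * (k + 1) = j.choose k * (j - k) := by
        rw [← Nat.cast_sub hkj]; exact_mod_cast h1
      linarith
    · rcases hkj.eq_or_lt with rfl | hlt
      · simp
      · simp [Nat.choose_eq_zero_of_lt hlt, Nat.choose_eq_zero_of_lt (hlt.trans k.lt_succ_self)]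
  calc (j : ℝ) ^ (r + 1) * j.choose k * coeff (Finsupp.single (1 : Fin 2) j) p =
      (j : ℝ) ^ r * (j * j.choose k) * coeff (Finsupp.single (1 : Fin 2) j) p := by ring
    _ = _ := by rw [this]; ring

theorem mixedMoment_zero (p : MvPolynomial (Fin 2) ℝ) (k : ℕ) :
    mixedMoment (rootForget p) 0 k = jetCoeff 0 k p := by
  obtain ⟨q, hq⟩ : ∃ q : Polynomial ℝ, rootForget p = Polynomial.aeval (X 1) q := by
    induction p using MvPolynomial.induction_on with
    | C a => exact ⟨Polynomial.C a, by rw [algHom_C, Polynomial.aeval_C]⟩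
    | add p p' hp hp' =>
      obtain ⟨q, hq⟩ := hp
      obtain ⟨q', hq'⟩ := hp'
      exact ⟨q + q', by rw [map_add, hq, hq', map_add]⟩
    | mul_X p i hp =>
      obtain ⟨q, hq⟩ := hp
      fin_cases i
      · exact ⟨q, by rw [map_mul, hq]; simp⟩
      · exact ⟨q * Polynomial.X, by rw [map_mul, hq, map_mul]; simp⟩
  have hcoeff : ∀ j, coeff (Finsupp.single (1 : Fin 2) j) (rootForget p) = q.coeff j := by
    intro j
    rw [hq, Polynomial.aeval_eq_sum_range' (n := max q.natDegree j + 1) (by omega), coeff_sum,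
      Finset.sum_eq_single j]
    · simp [coeff_X_pow]
    · intro i _ hij
      simp only [coeff_smul, coeff_X_pow, smul_eq_mul]
      rw [if_neg fun h => hij (Finsupp.single_injective _ h), mul_zero]
    · intro hj
      exact absurd (Finset.mem_range.2 (by omega)) hj
  set N := max q.natDegree (rootForget p).totalDegree + 1 with hN
  have hjet : jetCoeff 0 k p = ∑ j ∈ Finset.range N, (j.choose k : ℝ) * q.coeff j := by
    have h1 : jetCoeff 0 k p = jetCoeff 0 k (rootForget p) := by
      rw [jetCoeff_apply, jetCoeff_apply, jet_rootForget, Polynomial.coeff_C_zero]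
    rw [h1, hq, Polynomial.aeval_eq_sum_range' (n := N) (by omega), map_sum]
    refine Finset.sum_congr rfl fun j _ => ?_
    have := jetCoeff_monomial 0 k 0 j (q.coeff j)
    rw [pow_zero, one_mul, ← smul_eq_C_mul] at this
    rw [this]
    simp [mul_comm]
  rw [hjet, mixedMoment]
  simp only [hcoeff, pow_zero, one_mul]
  refine Finset.sum_subset (Finset.range_mono (by omega)) fun j _ hj => ?_
  rw [Finset.mem_range, not_lt] at hj
  rw [← hcoeff, coeff_eq_zero_of_totalDegree_lt, mul_zero]
  rw [Finsupp.support_single, Finset.sum_singleton, Finsupp.single_eq_same] <;> omega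

theorem IsMapCount.tendsto_mixedMoment {M : ℕ → ℝ} (hM : IsMapCount M)
    {Y : ℕ → MvPolynomial (Fin 2) ℝ}
    {α : ℕ → ℝ}
    (hα : ∀ k, Tendsto (scaled M k fun n => mixedMoment (Y n) 0 k) atTop (nhds (α k)))
    (r k : ℕ) :
    Tendsto (scaled M (k + r) fun n => mixedMoment (Y n) r k) atTop
      (nhds ((k + r).factorial / k.factorial * α (k + r))) := by
  induction r generalizing k with
  | zero =>
    have : (k.factorial : ℝ) ≠ 0 := by positivity
    simpa [this] using hα k
  | succ r ih =>
    have h1 := (ih (k + 1)).const_mul ((k : ℝ) + 1)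
    have h2 : Tendsto (fun n => k * (scaled M (k + r) (fun n => mixedMoment (Y n) r k) n *
        (1 / ((n : ℝ) + 1)))) atTop (nhds 0) := by
      simpa using ((ih k).mul tendsto_one_div_add_atTop_nhds_zero_nat).const_mul (k : ℝ)
    have h3 := h1.add h2
    rw [add_zero] at h3
    convert h3 using 1
    · ext n
      have := (hM.pos n).ne'
      have hn : (n : ℝ) + 1 ≠ 0 := by positivity
      simp only [scaled, mixedMoment_succ]
      rw [show k + (r + 1) = k + r + 1 by ring, show k + 1 + r = k + r + 1 by ring, pow_succ]
      field_simp
    · rw [show k + (r + 1) = k + 1 + r by ring, Nat.factorial_succ k]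
      push_cast
      congr 1
      field_simp

/-- The `(k, l)` jet coefficient of `y_i(1, w) * y_j`. -/
noncomputable def joinCoeff (y : ℕ → MvPolynomial (Fin 2) ℝ) (k l i j : ℕ) : ℝ :=
  ((Polynomial.C ((jet (y i)).coeff 0) * jet (y j)).coeff k).coeff l

/-- The `(k, l)` jet coefficient of `(v - 1) ^ a * (w - 1) ^ b * ∂_v y_n`. -/
noncomputable def shiftCoeff (y : ℕ → MvPolynomial (Fin 2) ℝ) (a b k l n : ℕ) : ℝ :=
  ((Polynomial.X ^ a * (Polynomial.C (Polynomial.X ^ b) *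
    Polynomial.derivative (jet (y n)))).coeff k).coeff l

theorem shiftCoeff_eq (y : ℕ → MvPolynomial (Fin 2) ℝ) (a b k l n : ℕ) :
    shiftCoeff y a b k l n =
      if a ≤ k ∧ b ≤ l then ((k - a : ℕ) + 1) * jetCoeff (k - a + 1) (l - b) (y n) else 0 := by
  rw [shiftCoeff, Polynomial.coeff_X_pow_mul']
  by_cases ha : a ≤ k
  · rw [if_pos ha, Polynomial.coeff_C_mul, Polynomial.coeff_X_pow_mul']
    by_cases hb : b ≤ l
    · rw [if_pos hb, if_pos ⟨ha, hb⟩, Polynomial.coeff_derivative, jetCoeff_apply]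
      rw [← Nat.cast_succ, ← Polynomial.C_eq_natCast, Polynomial.coeff_mul_C]
      push_cast; ring
    · rw [if_neg hb, if_neg (fun h => hb h.2)]
  · rw [if_neg ha, if_neg (fun h => ha h.1), Polynomial.coeff_zero]

namespace IsLoopSeq

variable {y : ℕ → MvPolynomial (Fin 2) ℝ} {M : ℕ → ℝ}

theorem mem_nonnegCone (h : IsLoopSeq y) (n : ℕ) : y n ∈ nonnegCone (2 * n) n := by
  induction n using Nat.strong_induction_on with
  | _ n ih =>
    rcases n with _ | n
    · rw [h.zero]
      simpa using _root_.mem_nonnegCone (c := 1) (i := 0) (j := 0) zero_le_one le_rfl le_rfl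
    · rw [h.succ]
      have h1 := nonnegCone_mul X_zero_mem_nonnegCone (ih n (by omega))
      have h2 := insertion_mem_nonnegCone (ih n (by omega))
      have h3 : ∑ i ∈ Finset.range (n + 1), rootForget (y i) * y (n - i) ∈
          nonnegCone (2 * n) n := by
        refine sum_mem fun i hi => ?_
        have hi' := Finset.mem_range.1 hi
        exact nonnegCone_mono (by omega) (by omega)
          (nonnegCone_mul (rootForget_mem_nonnegCone (ih i (by omega))) (ih (n - i) (by omega)))
      have h4 := nonnegCone_mul X_zero_mem_nonnegCone h3
      have h1' := nonnegCone_mono (a' := 2 * (n + 1)) (b' := n + 1) (by omega) (by omega) h1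
      have h4' := nonnegCone_mono (a' := 2 * (n + 1)) (b' := n + 1) (by omega) (by omega) h4
      have := add_mem (add_mem h1' h2) h4'
      convert this using 1
      ring

theorem jet_succ (h : IsLoopSeq y) (n : ℕ) :
    jet (y (n + 1)) =
      (2 * (n : ℝ) + 1) • jet (y n) + (2 * (n : ℝ) + 1) • (Polynomial.X * jet (y n)) +
      ∑ i ∈ Finset.range (n + 1), Polynomial.C ((jet (y i)).coeff 0) * jet (y (n - i)) +
      Polynomial.X *
        ∑ i ∈ Finset.range (n + 1), Polynomial.C ((jet (y i)).coeff 0) * jet (y (n - i)) +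
      Polynomial.X * (jet (y n)).derivative + Polynomial.C Polynomial.X * (jet (y n)).derivative +
      ((3 : ℝ) • (Polynomial.X ^ 1 * (Polynomial.C (Polynomial.X ^ 1) * (jet (y n)).derivative)) +
       (2 : ℝ) • (Polynomial.X ^ 2 * (Polynomial.C (Polynomial.X ^ 0) * (jet (y n)).derivative)) +
       (3 : ℝ) • (Polynomial.X ^ 2 * (Polynomial.C (Polynomial.X ^ 1) * (jet (y n)).derivative)) +
       (1 : ℝ) • (Polynomial.X ^ 3 * (Polynomial.C (Polynomial.X ^ 0) * (jet (y n)).derivative)) +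
       (1 : ℝ) • (Polynomial.X ^ 3 * (Polynomial.C (Polynomial.X ^ 1) * (jet (y n)).derivative))) := by
  have hs : ∀ (c : ℝ) (p : Polynomial (Polynomial ℝ)),
      c • p = Polynomial.C (Polynomial.C c) * p := fun c p => by
    rw [← Polynomial.smul_eq_C_mul]
    ext; simp
  rw [h.succ]
  simp only [map_add, map_mul, map_sum, map_sub, map_pow, map_one, jet_rootForget, jet_pderiv,
    jet_X_zero, jet_X_one, hs, map_natCast, map_ofNat]
  ring

theorem jetCoeff_zero_zero (h : IsLoopSeq y) (hM : IsMapCount M) (n : ℕ) :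
    jetCoeff 0 0 (y n) = M n := by
  induction n using Nat.strong_induction_on with
  | _ n ih =>
    rcases n with _ | n
    · simp [jetCoeff_apply, h.zero, hM.zero]
    · rw [jetCoeff_apply, h.jet_succ, hM.succ]
      simp [Polynomial.mul_coeff_zero, Polynomial.finsetSum_coeff, ← jetCoeff_apply]
      rw [ih n (by omega), add_comm]
      congr 1
      refine Finset.sum_congr rfl fun i hi => ?_
      have hi' := Finset.mem_range.1 hi
      rw [ih i (by omega), ih (n - i) (by omega)]

theorem abs_jetCoeff_le (h : IsLoopSeq y) (hM : IsMapCount M) (k l n : ℕ) :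
    |jetCoeff k l (y n)| ≤ 2 ^ k * ((n : ℝ) + 1) ^ (k + l) * M n := by
  have := jetCoeff_bounds (k := k) (l := l) (h.mem_nonnegCone n)
  rw [abs_of_nonneg this.1, ← h.jetCoeff_zero_zero hM]
  exact this.2

theorem joinCoeff_zero_left (h : IsLoopSeq y) (k l n : ℕ) :
    joinCoeff y k l 0 n = jetCoeff k l (y n) := by
  simp [joinCoeff, h.zero, jetCoeff_apply]

theorem joinCoeff_zero_right (h : IsLoopSeq y) (k l n : ℕ) :
    joinCoeff y k l n 0 = if k = 0 then jetCoeff k l (y n) else 0 := by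
  rcases k with _ | k
  · simp [joinCoeff, h.zero, jetCoeff_apply]
  · simp [joinCoeff, h.zero]

theorem abs_joinCoeff_le (h : IsLoopSeq y) (hM : IsMapCount M) (k l n : ℕ) {i j : ℕ}
    (hi : i ≤ n) (hj : j ≤ n) :
    |joinCoeff y k l i j| ≤ (l + 1) * 2 ^ k * ((n : ℝ) + 1) ^ (k + l) * (M i * M j) := by
  have hi' : (i : ℝ) ≤ n := by exact_mod_cast hi
  have hj' : (j : ℝ) ≤ n := by exact_mod_cast hj
  have pi := hM.pos i
  have pj := hM.pos j
  rw [joinCoeff, Polynomial.coeff_C_mul, Polynomial.coeff_mul]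
  calc |∑ x ∈ Finset.HasAntidiagonal.antidiagonal l, ((jet (y i)).coeff 0).coeff x.1 *
        ((jet (y j)).coeff k).coeff x.2|
      ≤ ∑ x ∈ Finset.HasAntidiagonal.antidiagonal l, |((jet (y i)).coeff 0).coeff x.1 *
        ((jet (y j)).coeff k).coeff x.2| := Finset.abs_sum_le_sum_abs _ _
    _ ≤ ∑ x ∈ Finset.HasAntidiagonal.antidiagonal l, 2 ^ k * ((n : ℝ) + 1) ^ (k + l) * (M i * M j) := by
      refine Finset.sum_le_sum fun x hx => ?_
      have hx' := Finset.HasAntidiagonal.mem_antidiagonal.1 hx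
      rw [← jetCoeff_apply, ← jetCoeff_apply, abs_mul]
      calc |jetCoeff 0 x.1 (y i)| * |jetCoeff k x.2 (y j)|
          ≤ (2 ^ 0 * ((i : ℝ) + 1) ^ (0 + x.1) * M i) *
            (2 ^ k * ((j : ℝ) + 1) ^ (k + x.2) * M j) := by
            gcongr
            · exact h.abs_jetCoeff_le hM 0 x.1 i
            · exact h.abs_jetCoeff_le hM k x.2 j
        _ ≤ (2 ^ 0 * ((n : ℝ) + 1) ^ (0 + x.1) * M i) *
            (2 ^ k * ((n : ℝ) + 1) ^ (k + x.2) * M j) := by gcongr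
        _ = _ := by rw [← hx']; ring
    _ = _ := by
      rw [Finset.sum_const, Finset.Nat.card_antidiagonal, nsmul_eq_mul]
      push_cast; ring

theorem sum_joinCoeff (h : IsLoopSeq y) (k l n : ℕ) :
    ∑ i ∈ Finset.range (n + 2), joinCoeff y k l i (n + 1 - i) =
      (1 + if k = 0 then 1 else 0) * jetCoeff k l (y (n + 1)) +
        ∑ i ∈ Finset.range n, joinCoeff y k l (i + 1) (n - i) := by
  rw [sum_range_succ_eq_ends_add_inner, h.joinCoeff_zero_left, h.joinCoeff_zero_right]
  split_ifs <;> ring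

theorem jetCoeff_succ (h : IsLoopSeq y) (k l n : ℕ) :
    jetCoeff k l (y (n + 1)) = (2 * (n : ℝ) + 1) * jetCoeff k l (y n) +
      (2 * (n : ℝ) + 1) * (if k = 0 then 0 else jetCoeff (k - 1) l (y n)) +
      ∑ i ∈ Finset.range (n + 1), joinCoeff y k l i (n - i) +
      (if k = 0 then 0 else ∑ i ∈ Finset.range (n + 1), joinCoeff y (k - 1) l i (n - i)) +
      k * jetCoeff k l (y n) +
      (if l = 0 then 0 else (k + 1) * jetCoeff (k + 1) (l - 1) (y n)) +
      (3 * shiftCoeff y 1 1 k l n + 2 * shiftCoeff y 2 0 k l n + 3 * shiftCoeff y 2 1 k l n +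
        1 * shiftCoeff y 3 0 k l n + 1 * shiftCoeff y 3 1 k l n) := by
  have hX : ∀ (p : Polynomial (Polynomial ℝ)), ((Polynomial.X * p).coeff k).coeff l =
      if k = 0 then 0 else (p.coeff (k - 1)).coeff l := by
    intro p
    rcases k with _ | k <;> simp
  have h1 : ((Polynomial.X * Polynomial.derivative (jet (y n))).coeff k).coeff l =
      k * jetCoeff k l (y n) := by
    have := shiftCoeff_eq y 1 0 k l n
    rw [shiftCoeff, pow_one, pow_zero, map_one, one_mul] at this
    rw [this]
    rcases k with _ | k <;> simp
  have h2 : ((Polynomial.C Polynomial.X * Polynomial.derivative (jet (y n))).coeff k).coeff l =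
      if l = 0 then 0 else (k + 1) * jetCoeff (k + 1) (l - 1) (y n) := by
    have := shiftCoeff_eq y 0 1 k l n
    rw [shiftCoeff, pow_one, pow_zero, one_mul] at this
    rw [this]
    rcases l with _ | l <;> simp
  rw [jetCoeff_apply, h.jet_succ]
  simp only [Polynomial.coeff_add, Polynomial.coeff_smul, smul_eq_mul, h1, h2, hX,
    Polynomial.finsetSum_coeff]
  rfl

theorem tendsto_scaled_shiftCoeff (h : IsLoopSeq y) (hM : IsMapCount M) (a b k l : ℕ)
    (hab : 2 ≤ a + b) :
    Tendsto (scaled M (k + l) (shiftCoeff y a b k l)) atTop (nhds 0) := by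
  by_cases hc : a ≤ k ∧ b ≤ l
  · refine hM.tendsto_scaled_zero (s := k - a + 1 + (l - b))
      (K := ((k - a : ℕ) + 1) * 2 ^ (k - a + 1)) (by omega) fun n => ?_
    rw [shiftCoeff_eq, if_pos hc, abs_mul, abs_of_nonneg (by positivity), mul_assoc, mul_assoc,
      ← mul_assoc (2 ^ _)]
    gcongr
    exact h.abs_jetCoeff_le hM _ _ n
  · have : scaled M (k + l) (shiftCoeff y a b k l) = fun _ => 0 := by
      ext n; simp [scaled, shiftCoeff_eq, if_neg hc]
    rw [this]; exact tendsto_const_nhds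

theorem tendsto_scaled_sum_joinCoeff (h : IsLoopSeq y) (hM : IsMapCount M) (k l : ℕ) :
    Tendsto (scaled M (k + 1 + l) fun n => ∑ i ∈ Finset.range (n + 1), joinCoeff y k l i (n - i))
      atTop (nhds 0) := by
  refine hM.tendsto_scaled_zero (s := k + l) (K := (l + 1) * 2 ^ k * 11) (by omega) fun n => ?_
  calc |∑ i ∈ Finset.range (n + 1), joinCoeff y k l i (n - i)|
      ≤ ∑ i ∈ Finset.range (n + 1), |joinCoeff y k l i (n - i)| := Finset.abs_sum_le_sum_abs _ _
    _ ≤ ∑ i ∈ Finset.range (n + 1),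
        (l + 1) * 2 ^ k * ((n : ℝ) + 1) ^ (k + l) * (M i * M (n - i)) := by
      refine Finset.sum_le_sum fun i hi => ?_
      have := Finset.mem_range.1 hi
      exact h.abs_joinCoeff_le hM k l n (by omega) (by omega)
    _ ≤ (l + 1) * 2 ^ k * ((n : ℝ) + 1) ^ (k + l) * (11 * M n) := by
      rw [← Finset.mul_sum]
      gcongr
      exact hM.conv_le n
    _ = _ := by ring

theorem tendsto_scaled_innerJoin (h : IsLoopSeq y) (hM : IsMapCount M) (k l : ℕ) :
    Tendsto (scaled M (k + l) fun n =>
      ∑ i ∈ Finset.range (n - 1), joinCoeff y k l (i + 1) (n - 1 - i)) atTop (nhds 0) := by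
  have hlim := hM.tendsto_innerConv_div.const_mul (((l : ℝ) + 1) * 2 ^ k)
  rw [mul_zero] at hlim
  refine squeeze_zero_norm (fun n => ?_) hlim
  have hp := hM.pos n
  have hs : |∑ i ∈ Finset.range (n - 1), joinCoeff y k l (i + 1) (n - 1 - i)| ≤
      ((l : ℝ) + 1) * 2 ^ k * ((n : ℝ) + 1) ^ (k + l) * innerConv M n := by
    rw [innerConv, Finset.mul_sum]
    refine (Finset.abs_sum_le_sum_abs _ _).trans (Finset.sum_le_sum fun i hi => ?_)
    have := Finset.mem_range.1 hi
    exact h.abs_joinCoeff_le hM k l n (by omega) (by omega)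
  rw [scaled, Real.norm_eq_abs, abs_div, abs_of_pos (by positivity : 0 < ((n : ℝ) + 1) ^ _ * M n),
    div_le_iff₀ (by positivity)]
  refine hs.trans_eq ?_
  field_simp

theorem tendsto_scaled_jetCoeff_pred {α : ℕ → ℕ → ℝ} (k l : ℕ)
    (ih : k ≠ 0 → Tendsto (scaled M (k - 1 + l) fun n => jetCoeff (k - 1) l (y n)) atTop
      (nhds (α (k - 1) l))) :
    Tendsto (scaled M (k + l) fun n => (2 * (n : ℝ) + 1) *
      (if k = 0 then 0 else jetCoeff (k - 1) l (y n))) atTop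
      (nhds (2 * if k = 0 then 0 else α (k - 1) l)) := by
  rcases k with _ | k
  · simpa using tendsto_scaled_const_zero M _
  · simp only [Nat.add_sub_cancel, Nat.add_eq_zero_iff, one_ne_zero, and_false, if_false] at ih ⊢
    have h2 : Tendsto (fun n : ℕ => 2 - 1 / ((n : ℝ) + 1)) atTop (nhds 2) := by
      simpa using tendsto_one_div_add_atTop_nhds_zero_nat.const_sub (2 : ℝ)
    refine (h2.mul (ih (by simp))).congr fun n => ?_
    have hn : (n : ℝ) + 1 ≠ 0 := by positivity
    rw [scaled, scaled, show k + 1 + l = k + l + 1 by ring, pow_succ]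
    by_cases hMn : M n = 0
    · simp [hMn]
    · field_simp
      ring

theorem tendsto_jetCoeff_step (h : IsLoopSeq y) (hM : IsMapCount M) {α : ℕ → ℕ → ℝ} (k l : ℕ)
    (hkl : ¬(k = 0 ∧ l = 0))
    (hα : ((k : ℝ) + 2 * l + if 0 < k then 1 else 0) * α k l =
      2 * (if k = 0 then 0 else α (k - 1) l) + if l = 0 then 0 else (k + 1) * α (k + 1) (l - 1))
    (ihk : k ≠ 0 → Tendsto (scaled M (k - 1 + l) fun n => jetCoeff (k - 1) l (y n)) atTop
      (nhds (α (k - 1) l)))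
    (ihl : l ≠ 0 → Tendsto (scaled M (k + 1 + (l - 1)) fun n => jetCoeff (k + 1) (l - 1) (y n))
      atTop (nhds (α (k + 1) (l - 1)))) :
    Tendsto (scaled M (k + l) fun n => jetCoeff k l (y n)) atTop (nhds (α k l)) := by
  set c : ℝ := (k : ℝ) + 2 * l + if 0 < k then 1 else 0 with hc
  have hc0 : 0 < c := by
    rcases Nat.eq_zero_or_pos k with rfl | hk
    · have : 0 < l := Nat.pos_of_ne_zero fun h0 => hkl ⟨rfl, h0⟩
      have : (0 : ℝ) < l := by exact_mod_cast this
      simp [hc, this]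
    · rw [hc, if_pos hk]; positivity
  set g : ℕ → ℝ := fun n =>
    (((n : ℝ) + 2) ^ (k + l) * M (n + 1)) / (((n : ℝ) + 1) ^ (k + l) * M n) with hg
  set q : ℝ := 2 + k + if k = 0 then 1 else 0 with hq
  have hglim := hM.tendsto_growth_sub (k + l)
  have hd : Tendsto (fun n : ℕ => g n - (2 * (n : ℝ) + q)) atTop (nhds c) := by
    have := hglim.sub_const q
    convert this using 2
    · rw [hg]; ring
    · rw [hc, hq]
      rcases Nat.eq_zero_or_pos k with rfl | hk
      · simp; ring
      · simp [hk, hk.ne']; ring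
  set a : ℕ → ℝ := scaled M (k + l) fun n => jetCoeff k l (y n) with ha
  have hr : Tendsto (fun n => g n * a (n + 1) - (2 * (n : ℝ) + q) * a n) atTop
      (nhds (c * α k l)) := by
    have hP := tendsto_scaled_jetCoeff_pred (y := y) (M := M) k l ihk
    have hJ : Tendsto (scaled M (k + l) fun n => if k = 0 then 0 else
        ∑ i ∈ Finset.range (n + 1), joinCoeff y (k - 1) l i (n - i)) atTop (nhds 0) := by
      rcases k with _ | k
      · simpa using tendsto_scaled_const_zero M _
      · simpa using h.tendsto_scaled_sum_joinCoeff hM k l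
    have hL : Tendsto (scaled M (k + l) fun n => if l = 0 then 0 else
        (k + 1) * jetCoeff (k + 1) (l - 1) (y n)) atTop
        (nhds (if l = 0 then 0 else (k + 1) * α (k + 1) (l - 1))) := by
      rcases l with _ | l
      · simpa using tendsto_scaled_const_zero M _
      · have := (ihl (by simp)).const_mul ((k : ℝ) + 1)
        simp only [Nat.add_sub_cancel, Nat.add_eq_zero_iff, one_ne_zero, and_false, if_false]
          at this ⊢
        refine this.congr fun n => ?_
        rw [scaled, scaled, show k + 1 + l = k + (l + 1) by ring, mul_div_assoc]
    have hI := h.tendsto_scaled_innerJoin hM k l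
    have hS := fun a b hab => h.tendsto_scaled_shiftCoeff hM a b k l hab
    have hlow := (((((hS 1 1 (by norm_num)).const_mul 3).add
      ((hS 2 0 (by norm_num)).const_mul 2)).add ((hS 2 1 (by norm_num)).const_mul 3)).add
      ((hS 3 0 (by norm_num)).const_mul 1)).add ((hS 3 1 (by norm_num)).const_mul 1)
    have hall := (((hP.add hL).add hJ).add hI).add hlow
    rw [hα]
    simp only [mul_zero, add_zero] at hall
    refine hall.congr' ?_
    filter_upwards [eventually_ge_atTop 1] with n hn
    have hrec := h.jetCoeff_succ k l n
    obtain ⟨n, rfl⟩ : ∃ j, n = j + 1 := ⟨n - 1, by omega⟩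
    rw [h.sum_joinCoeff] at hrec
    have hW : (((n + 1 : ℕ) : ℝ) + 1) ^ (k + l) * M (n + 1) ≠ 0 := by
      have := hM.pos (n + 1)
      positivity
    have hga : g (n + 1) * a (n + 1 + 1) =
        jetCoeff k l (y (n + 1 + 1)) / ((((n + 1 : ℕ) : ℝ) + 1) ^ (k + l) * M (n + 1)) := by
      have := hM.pos (n + 1 + 1)
      rw [hg, ha, scaled]
      have e : (((n + 1 + 1 : ℕ) : ℝ) + 1) = ((n + 1 : ℕ) : ℝ) + 2 := by push_cast; ring
      rw [e]
      have : ((((n + 1 : ℕ) : ℝ) + 2) ^ (k + l) * M (n + 1 + 1)) ≠ 0 := by positivity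
      field_simp
    rw [hga, hrec, ha, hq]
    simp only [scaled, Nat.add_sub_cancel]
    generalize ((((n + 1 : ℕ) : ℝ) + 1) ^ (k + l) * M (n + 1)) = W at hW
    field_simp
    ring
  have := tendsto_of_linear_recursion (a := a) hc0 hglim hd hr (fun n => by
    simp only [hg]; ring)
  rwa [mul_div_cancel_left₀ _ hc0.ne'] at this

theorem tendsto_jetCoeff (h : IsLoopSeq y) (hM : IsMapCount M) {α : ℕ → ℕ → ℝ}
    (hα0 : α 0 0 = 1)
    (hα : ∀ k l : ℕ, ¬(k = 0 ∧ l = 0) → ((k : ℝ) + 2 * l + if 0 < k then 1 else 0) * α k l =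
      2 * (if k = 0 then 0 else α (k - 1) l) + if l = 0 then 0 else (k + 1) * α (k + 1) (l - 1))
    (l k : ℕ) :
    Tendsto (scaled M (k + l) fun n => jetCoeff k l (y n)) atTop (nhds (α k l)) := by
  have hstep : ∀ k l, (k ≠ 0 → Tendsto (scaled M (k - 1 + l) fun n => jetCoeff (k - 1) l (y n))
      atTop (nhds (α (k - 1) l))) → (l ≠ 0 → Tendsto
        (scaled M (k + 1 + (l - 1)) fun n => jetCoeff (k + 1) (l - 1) (y n))
      atTop (nhds (α (k + 1) (l - 1)))) →
      Tendsto (scaled M (k + l) fun n => jetCoeff k l (y n)) atTop (nhds (α k l)) := by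
    intro k l hk hl
    by_cases hkl : k = 0 ∧ l = 0
    · obtain ⟨rfl, rfl⟩ := hkl
      rw [hα0]
      refine tendsto_const_nhds.congr fun n => ?_
      have := (hM.pos n).ne'
      simp [scaled, h.jetCoeff_zero_zero hM, this]
    · exact h.tendsto_jetCoeff_step hM k l hkl (hα k l hkl) hk hl
  induction l generalizing k with
  | zero =>
    induction k with
    | zero => exact hstep 0 0 (by simp) (by simp)
    | succ k ihk => exact hstep (k + 1) 0 (fun _ => ihk) (by simp)
  | succ l ihl =>
    induction k with
    | zero => exact hstep 0 (l + 1) (by simp) (fun _ => ihl 1)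
    | succ k ihk => exact hstep (k + 1) (l + 1) (fun _ => ihk) (fun _ => ihl (k + 1 + 1))

end IsLoopSeq

/-- Let `Y_n` be the number of loops of a uniform random rooted map with
`n` edges, i.e. `P(Y_n = j) = y_{n,j}/m(n)` where `y_{n,j}` is the coefficient of `w^j` in
`y_n(1,w)`. Then for every `ℓ ≥ 0`, the `ℓ`-th moment of `Y_n/n` converges:
`lim_{n→∞} (Σ_{j≥0} j^ℓ·y_{n,j}) / (n^ℓ·m(n)) = η(0,ℓ)/2`. -/
theorem loops_moment_convergence
    (m : ℕ → ℕ) (hm0 : m 0 = 1)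
    (hm : ∀ n : ℕ, m (n + 1) =
      (∑ k ∈ Finset.range (n + 1), m k * m (n - k)) + (2 * (n + 1) - 1) * m n)
    (y : ℕ → MvPolynomial (Fin 2) ℝ) (hy0 : y 0 = 1)
    (hy : ∀ n : ℕ, y (n + 1) =
      X 0 * y n + C (2 * (n : ℝ)) * X 0 * y n +
        X 0 * ∑ i ∈ Finset.range (n + 1),
          (aeval (fun j : Fin 2 => if j = 0 then (1 : MvPolynomial (Fin 2) ℝ) else X 1)
              (y i)) * y (n - i) +
        X 0 ^ 2 * (X 0 * X 1 - 1) * pderiv (0 : Fin 2) (y n))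
    (Y : ℕ → MvPolynomial (Fin 2) ℝ)
    (hY : ∀ n, Y n =
      aeval (fun j : Fin 2 => if j = 0 then (1 : MvPolynomial (Fin 2) ℝ) else X 1) (y n))
    (η : ℕ → ℕ → ℝ) (hη0 : η 0 0 = 2)
    (hη : ∀ k ℓ : ℕ, ¬(k = 0 ∧ ℓ = 0) →
      η k ℓ = (2 * (k : ℝ) * η (k - 1) ℓ + (ℓ : ℝ) * η (k + 1) (ℓ - 1)) /
        ((k : ℝ) + 2 * (ℓ : ℝ) + if 0 < k then 1 else 0)) :
    ∀ ℓ : ℕ,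
      Tendsto
        (fun n : ℕ =>
          (∑ j ∈ Finset.range ((Y n).totalDegree + 1),
              (j : ℝ) ^ ℓ * coeff (Finsupp.single (1 : Fin 2) j) (Y n)) /
            ((n : ℝ) ^ ℓ * (m n : ℝ)))
        atTop (nhds (η 0 ℓ / 2)) := by
  have hM : IsMapCount fun n => (m n : ℝ) := by
    refine ⟨by simp [hm0], fun n => ?_⟩
    rw [hm, show 2 * (n + 1) - 1 = 2 * n + 1 by omega]
    push_cast
    ring
  have hL : IsLoopSeq y := ⟨hy0, hy⟩
  set α : ℕ → ℕ → ℝ := fun k l => η k l / (2 * k.factorial * l.factorial) with hα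
  have hα0 : α 0 0 = 1 := by simp [hα, hη0]
  have hαrec : ∀ k l : ℕ, ¬(k = 0 ∧ l = 0) →
      ((k : ℝ) + 2 * l + if 0 < k then 1 else 0) * α k l =
        2 * (if k = 0 then 0 else α (k - 1) l) +
          if l = 0 then 0 else (k + 1) * α (k + 1) (l - 1) := by
    intro k l hkl
    have hpos : ((k : ℝ) + 2 * l + if 0 < k then 1 else 0) ≠ 0 := by
      have : 0 < (k : ℝ) + 2 * l := by
        have : 0 < k + 2 * l := by omega
        exact_mod_cast this
      split_ifs <;> positivity
    have h := hη k l hkl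
    rw [eq_div_iff hpos] at h
    have e : ((k : ℝ) + 2 * l + if 0 < k then 1 else 0) * α k l =
        (2 * (k : ℝ) * η (k - 1) l + (l : ℝ) * η (k + 1) (l - 1)) /
          (2 * k.factorial * l.factorial) := by
      rw [← h, hα]; ring
    rw [e]
    rcases k with _ | k <;> rcases l with _ | l <;>
      simp [hα, Nat.factorial_succ] <;> field_simp
  have hjet := hL.tendsto_jetCoeff hM hα0 hαrec
  have hmom := hM.tendsto_mixedMoment (Y := Y) (α := fun k => α 0 k) (fun k => by
    have := hjet k 0
    rw [zero_add] at this
    refine this.congr fun n => ?_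
    rw [scaled, scaled, hY, ← mixedMoment_zero])
  intro l
  have hx : Tendsto (fun n : ℕ => (1 + 1 / (n : ℝ)) ^ l) atTop (nhds 1) := by
    simpa using (tendsto_one_div_atTop_nhds_zero_nat.const_add (1 : ℝ)).pow l
  have hfin := (hmom l 0).mul hx
  have hlim : ((0 + l).factorial / (0 : ℕ).factorial * α 0 (0 + l)) * 1 = η 0 l / 2 := by
    simp [hα]
    field_simp
  rw [hlim] at hfin
  refine hfin.congr' ?_
  filter_upwards [eventually_gt_atTop 0] with n hn
  have hn' : (0 : ℝ) < n := by exact_mod_cast hn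
  have hmn := hM.pos n
  have e : (1 + 1 / (n : ℝ)) ^ l = ((n : ℝ) + 1) ^ l / (n : ℝ) ^ l := by
    rw [← div_pow]; congr 1; field_simp
  simp only [scaled, mixedMoment, e, zero_add, Nat.choose_zero_right,
    Nat.cast_one, mul_one]
  field_simp
end

section
/- There exists a Borel probability measure μ on the interval [0,1] such that ∫ x^ℓ dμ(x) = η(0,ℓ)/2 for every integer ℓ ≥ 0, and the number of loops Y_n of a uniform random rooted map with n edges satisfies Y_n/n → μ in distribution: for every bounded continuous f : ℝ → ℝ, lim_{n→∞} (Σ_{j≥0} f(j/n)·y_{n,j}) / m(n) = ∫ f dμ, where y_{n,j} is the coefficient of w^j in y_n(1,w). -/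
open MvPolynomial Filter MeasureTheory

lemma mul_le_mul_of_ratio_bounds {m : ℕ → ℕ} {N : ℕ}
    (lower : ∀ j, 1 ≤ j → (2 * j + 3) * m j ≤ m (j + 1))
    (upper : ∀ j < N, m (j + 1) ≤ (2 * j + 5) * m j) {s : ℕ} (hs : 1 ≤ s) :
    ∀ i j, i ≤ j → s + i ≤ N → m (s + i) * m (s + j) ≤ m s * m (s + i + j) := by
  intro i
  induction i with
  | zero => intro j _ _; simp
  | succ i ih =>
    intro j hij hN
    have h1 := upper (s + i) (by omega)
    have h2 := lower (s + j) (by omega)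
    have h3 := ih (j + 1) (by omega) (by omega)
    calc m (s + (i + 1)) * m (s + j)
        ≤ ((2 * (s + i) + 5) * m (s + i)) * m (s + j) := Nat.mul_le_mul_right _ h1
      _ ≤ ((2 * (s + j) + 3) * m (s + i)) * m (s + j) := 
          Nat.mul_le_mul_right _ (Nat.mul_le_mul_right _ (by omega))
      _ = m (s + i) * ((2 * (s + j) + 3) * m (s + j)) := by ring
      _ ≤ m (s + i) * m (s + (j + 1)) := Nat.mul_le_mul_left _ h2
      _ ≤ _ := h3
      _ = _ := by congr 2; omega

lemma mul_le_mul_of_ratio_bounds' {m : ℕ → ℕ} {n : ℕ}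
    (lower : ∀ j, 1 ≤ j → (2 * j + 3) * m j ≤ m (j + 1))
    (upper : ∀ j < n, m (j + 1) ≤ (2 * j + 5) * m j) {s i : ℕ} (hs : 1 ≤ s) (hi : s ≤ i)
    (hin : i + s ≤ n) : m i * m (n - i) ≤ m s * m (n - s) := by
  rcases le_total i (n - i) with h | h
  · have := mul_le_mul_of_ratio_bounds lower upper hs (i - s) (n - i - s) (by omega) (by omega)
    convert this using 3 <;> omega
  · have := mul_le_mul_of_ratio_bounds lower upper hs (n - i - s) (i - s) (by omega) (by omega)
    rw [mul_comm (m i)]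
    convert this using 3 <;> omega

lemma sum_range_succ_eq_ends {M : Type*} [AddCommMonoid M] (f : ℕ → M) {n : ℕ} (hn : 1 ≤ n) :
    ∑ k ∈ Finset.range (n + 1), f k = f 0 + f n + ∑ k ∈ Finset.Ico 1 n, f k := by
  rw [Finset.sum_range_succ, Finset.range_eq_Ico, Finset.sum_eq_sum_Ico_succ_bot (by omega)]
  abel

section MapCounts

variable {m : ℕ → ℕ} (hm0 : m 0 = 1)
  (hm : ∀ n : ℕ, m (n + 1) =
      (∑ k ∈ Finset.range (n + 1), m k * m (n - k)) + (2 * (n + 1) - 1) * m n)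
include hm0 hm

lemma mapCount_succ {n : ℕ} (hn : 1 ≤ n) :
    m (n + 1) = (2 * n + 3) * m n + ∑ k ∈ Finset.Ico 1 n, m k * m (n - k) := by
  rw [hm, sum_range_succ_eq_ends _ hn, hm0, Nat.sub_self, Nat.sub_zero, hm0,
    show 2 * (n + 1) - 1 = 2 * n + 1 by omega]
  ring

lemma mapCount_one : m 1 = 2 := by simp [hm, hm0]

lemma mapCount_two : m 2 = 10 := by
  rw [mapCount_succ hm0 hm le_rfl, mapCount_one hm0 hm]; simp

lemma mapCount_lower (j : ℕ) (hj : 1 ≤ j) : (2 * j + 3) * m j ≤ m (j + 1) := by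
  rw [mapCount_succ hm0 hm hj]; omega

lemma mapCount_pos (n : ℕ) : 0 < m n := by
  induction n with
  | zero => simp [hm0]
  | succ n ih =>
    rw [hm]
    exact Nat.add_pos_right _ (Nat.mul_pos (by omega) ih)

lemma mapCount_upper (n : ℕ) : m (n + 1) ≤ (2 * n + 5) * m n := by
  induction n using Nat.strong_induction_on with
  | _ n ih =>
    rcases Nat.eq_zero_or_pos n with rfl | hn
    · simp [mapCount_one hm0 hm, hm0]
    · rw [mapCount_succ hm0 hm hn]
      suffices h : ∑ k ∈ Finset.Ico 1 n, m k * m (n - k) ≤ 2 * m n by linarith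
      rcases eq_or_lt_of_le (show 1 ≤ n from hn) with rfl | hn'
      · simp
      · have h1 : ∑ k ∈ Finset.Ico 1 n, m k * m (n - k) ≤ (n - 1) * (m 1 * m (n - 1)) := by
          have := Finset.sum_le_card_nsmul (Finset.Ico 1 n) (fun k => m k * m (n - k))
            (m 1 * m (n - 1)) fun k hk => by
              rw [Finset.mem_Ico] at hk
              exact mul_le_mul_of_ratio_bounds' (mapCount_lower hm0 hm) ih le_rfl hk.1 (by omega)
          simpa using this
        have h2 := mapCount_lower hm0 hm (n - 1) (by omega)
        rw [mapCount_one hm0 hm] at h1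
        obtain ⟨k, rfl⟩ : ∃ k, n = k + 1 := ⟨n - 1, by omega⟩
        simp only [Nat.add_sub_cancel] at h1 h2 ⊢
        nlinarith

lemma mapCount_convolution_le (n : ℕ) :
    (2 * n + 1) * ∑ k ∈ Finset.Ico 1 n, m k * m (n - k) ≤ 9 * m n := by
  rcases Nat.lt_or_ge n 3 with h | h
  · interval_cases n <;>
      simp [mapCount_one hm0 hm, mapCount_two hm0 hm]
  obtain ⟨r, rfl⟩ : ∃ r, n = r + 2 := ⟨n - 2, by omega⟩
  have hs : ∑ k ∈ Finset.Ico 1 (r + 2), m k * m (r + 2 - k) ≤ 4 * m (r + 1) + 10 * r * m r := by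
    rw [Finset.sum_eq_sum_Ico_succ_bot (by omega), Finset.sum_Ico_succ_top (by omega)]
    have h1 : ∑ k ∈ Finset.Ico (1 + 1) (r + 1), m k * m (r + 2 - k) ≤
        (r - 1) * (m 2 * m (r + 2 - 2)) := by
      have := Finset.sum_le_card_nsmul (Finset.Ico (1 + 1) (r + 1))
        (fun k => m k * m (r + 2 - k)) (m 2 * m (r + 2 - 2)) fun k hk => by
          rw [Finset.mem_Ico] at hk
          exact mul_le_mul_of_ratio_bounds' (mapCount_lower hm0 hm)
            (fun j _ => mapCount_upper hm0 hm j) (by omega) hk.1 (by omega)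
      simpa using this
    rw [mapCount_two hm0 hm] at h1
    rw [mapCount_one hm0 hm, show r + 2 - (r + 1) = 1 by omega, mapCount_one hm0 hm,
      show r + 2 - 1 = r + 1 by omega]
    have h2 : (r - 1) * (10 * m (r + 2 - 2)) ≤ 10 * r * m r := by
      rw [Nat.add_sub_cancel]
      calc (r - 1) * (10 * m r) ≤ r * (10 * m r) := by gcongr; omega
        _ = _ := by ring
    linarith
  have h2 := mapCount_lower hm0 hm (r + 1) (by omega)
  have h3 := mapCount_lower hm0 hm r (by omega)
  have h4 : (2 * r + 5) * (10 * r * m r) ≤ 5 * m (r + 2) := by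
    calc (2 * r + 5) * (10 * r * m r) ≤ (2 * r + 5) * (5 * ((2 * r + 3) * m r)) := by
          gcongr 1
          nlinarith [Nat.zero_le (m r)]
      _ ≤ (2 * r + 5) * (5 * m (r + 1)) := by gcongr
      _ = 5 * ((2 * (r + 1) + 3) * m (r + 1)) := by ring
      _ ≤ 5 * m (r + 2) := by gcongr
  calc _ ≤ (2 * r + 5) * (4 * m (r + 1) + 10 * r * m r) := by
        rw [show 2 * (r + 2) + 1 = 2 * r + 5 by ring]; gcongr
    _ = 4 * ((2 * (r + 1) + 3) * m (r + 1)) + (2 * r + 5) * (10 * r * m r) := by ring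
    _ ≤ 4 * m (r + 2) + 5 * m (r + 2) := by gcongr
    _ = _ := by ring

end MapCounts

/-- The pairing `∑ c_{a,b} v^a w^b ↦ ∑ c_{a,b} g(a,b)` of test functions with polynomials. -/
noncomputable def coeffPairing :
    (ℕ → ℕ → ℝ) →ₗ[ℝ] MvPolynomial (Fin 2) ℝ →ₗ[ℝ] ℝ :=
  ((basisMonomials (Fin 2) ℝ).constr ℝ).toLinearMap ∘ₗ
    { toFun := fun g d => g (d 0) (d 1)
      map_add' := fun _ _ => rfl
      map_smul' := fun _ _ => rfl }

/-- Setting the first variable to `1`. -/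
noncomputable def setVOne : MvPolynomial (Fin 2) ℝ →ₐ[ℝ] MvPolynomial (Fin 2) ℝ :=
  aeval (fun j : Fin 2 => if j = 0 then (1 : MvPolynomial (Fin 2) ℝ) else X 1)

lemma coeffPairing_monomial (g : ℕ → ℕ → ℝ) (d : Fin 2 →₀ ℕ) (c : ℝ) :
    coeffPairing g (monomial d c) = c * g (d 0) (d 1) := by
  have h : monomial d c = c • (basisMonomials (Fin 2) ℝ d) := by
    simp [coe_basisMonomials, smul_monomial]
  rw [h, map_smul]
  simp [coeffPairing, Module.Basis.constr_basis, -coe_basisMonomials]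

lemma coeffPairing_one (g : ℕ → ℕ → ℝ) : coeffPairing g 1 = g 0 0 := by
  simpa using coeffPairing_monomial g 0 1

lemma coeffPairing_X_zero_mul (g : ℕ → ℕ → ℝ) (p : MvPolynomial (Fin 2) ℝ) :
    coeffPairing g (X 0 * p) = coeffPairing (fun a b => g (a + 1) b) p := by
  induction p using MvPolynomial.induction_on' with
  | monomial d c =>
    rw [X, monomial_mul, coeffPairing_monomial, coeffPairing_monomial]
    simp [add_comm]
  | add p q hp hq => rw [mul_add, map_add, map_add, hp, hq]

lemma coeffPairing_X_one_mul (g : ℕ → ℕ → ℝ) (p : MvPolynomial (Fin 2) ℝ) :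
    coeffPairing g (X 1 * p) = coeffPairing (fun a b => g a (b + 1)) p := by
  induction p using MvPolynomial.induction_on' with
  | monomial d c =>
    rw [X, monomial_mul, coeffPairing_monomial, coeffPairing_monomial]
    simp [add_comm]
  | add p q hp hq => rw [mul_add, map_add, map_add, hp, hq]

lemma coeffPairing_X_zero_mul_pderiv (g : ℕ → ℕ → ℝ) (p : MvPolynomial (Fin 2) ℝ) :
    coeffPairing g (X 0 * pderiv 0 p) = coeffPairing (fun a b => a * g a b) p := by
  induction p using MvPolynomial.induction_on' with
  | monomial d c =>
    rw [coeffPairing_X_zero_mul, pderiv_monomial, coeffPairing_monomial, coeffPairing_monomial]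
    rcases Nat.eq_zero_or_pos (d 0) with h | h
    · simp [h]
    · simp [Nat.sub_add_cancel h, mul_assoc]
  | add p q hp hq => rw [map_add, mul_add, map_add, map_add, hp, hq]

lemma setVOne_monomial (d : Fin 2 →₀ ℕ) (c : ℝ) :
    setVOne (monomial d c) = monomial (Finsupp.single 1 (d 1)) c := by
  rw [setVOne, aeval_monomial, Finsupp.prod_fintype _ _ (by simp), Fin.prod_univ_two]
  simp [X_pow_eq_monomial, C_mul_monomial, algebraMap_eq]

lemma coeffPairing_setVOne_mul (g : ℕ → ℕ → ℝ) (p q : MvPolynomial (Fin 2) ℝ) :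
    coeffPairing g (setVOne p * q) =
      coeffPairing (fun _ b' => coeffPairing (fun a b => g a (b + b')) q) p := by
  induction p using MvPolynomial.induction_on' with
  | monomial d c =>
    rw [setVOne_monomial, coeffPairing_monomial]
    induction q using MvPolynomial.induction_on' with
    | monomial e c' =>
      rw [monomial_mul, coeffPairing_monomial, coeffPairing_monomial]
      simp [add_comm, mul_assoc]
    | add p q hp hq => rw [mul_add, map_add, map_add, hp, hq, mul_add]
  | add p q hp hq => rw [map_add, add_mul, map_add, map_add, hp, hq]

lemma coeff_setVOne (p : MvPolynomial (Fin 2) ℝ) (j : ℕ) :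
    coeff (Finsupp.single 1 j) (setVOne p) = coeffPairing (fun _ b => if b = j then 1 else 0) p := by
  induction p using MvPolynomial.induction_on' with
  | monomial d c =>
    rw [setVOne_monomial, coeffPairing_monomial, coeff_monomial]
    simp [(Finsupp.single_injective (1 : Fin 2)).eq_iff]
  | add p q hp hq => rw [map_add, coeff_add, map_add, hp, hq]

lemma coeffPairing_succ {y : ℕ → MvPolynomial (Fin 2) ℝ}
    (hy : ∀ n : ℕ, y (n + 1) =
      X 0 * y n + C (2 * (n : ℝ)) * X 0 * y n +
        X 0 * ∑ i ∈ Finset.range (n + 1),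
          (aeval (fun j : Fin 2 => if j = 0 then (1 : MvPolynomial (Fin 2) ℝ) else X 1)
              (y i)) * y (n - i) +
        X 0 ^ 2 * (X 0 * X 1 - 1) * pderiv (0 : Fin 2) (y n)) (n : ℕ) (g : ℕ → ℕ → ℝ) :
    coeffPairing g (y (n + 1)) =
      coeffPairing (fun a b => (2 * n + 1 - a) * g (a + 1) b + a * g (a + 2) (b + 1)) (y n) +
      ∑ i ∈ Finset.range (n + 1), coeffPairing
        (fun _ b' => coeffPairing (fun a b => g (a + 1) (b + b')) (y (n - i))) (y i) := by
  obtain ⟨q, hq⟩ : ∃ q, q = X 0 * pderiv 0 (y n) := ⟨_, rfl⟩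
  have hq' (g) : coeffPairing g q = coeffPairing (fun a b => a * g a b) (y n) := by
    rw [hq, coeffPairing_X_zero_mul_pderiv]
  have h : y (n + 1) = X 0 * y n + (2 * (n : ℝ)) • (X 0 * y n) +
      X 0 * ∑ i ∈ Finset.range (n + 1), setVOne (y i) * y (n - i) +
      (X 0 * (X 1 * (X 0 * q)) - X 0 * q) := by
    rw [hy, smul_eq_C_mul, setVOne, hq]; ring
  rw [h, map_add, map_add, map_add, map_sub, map_smul]
  simp only [coeffPairing_X_zero_mul, coeffPairing_X_one_mul, map_sum, coeffPairing_setVOne_mul,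
    hq']
  have h2 : (fun a b => (2 * (n : ℝ) + 1 - a) * g (a + 1) b + a * g (a + 2) (b + 1)) =
      (fun a b => g (a + 1) b) + (2 * (n : ℝ)) • (fun a b => g (a + 1) b) +
        ((fun (a : ℕ) b => (a : ℝ) * g (a + 1 + 1) (b + 1)) -
          (fun (a : ℕ) b => (a : ℝ) * g (a + 1) b)) := by
    funext a b
    simp only [Pi.add_apply, Pi.sub_apply, Pi.smul_apply, smul_eq_mul]
    ring
  rw [h2, map_add, map_add, map_sub, map_smul]
  simp only [LinearMap.add_apply, LinearMap.sub_apply, LinearMap.smul_apply]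
  ring

lemma exists_continuous_add_pow_expansion (k : ℕ) :
    ∃ p : ℝ × ℝ → ℝ, Continuous p ∧
      ∀ x h : ℝ, (x + h) ^ k = x ^ k + k * x ^ (k - 1) * h + h ^ 2 * p (x, h) := by
  induction k with
  | zero => exact ⟨0, continuous_zero, by simp⟩
  | succ k ih =>
    obtain ⟨p, hp, hk⟩ := ih
    refine ⟨fun u => (u.1 + u.2) * p u + k * u.1 ^ (k - 1), by fun_prop, fun x h => ?_⟩
    rw [pow_succ, hk]
    have : (k : ℝ) * x ^ k = k * x ^ (k - 1) * x := by
      rcases k with _ | k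
      · simp
      · simp [pow_succ, mul_assoc]
    simp only [Nat.add_sub_cancel]
    push_cast
    linear_combination (-h) * this

lemma exists_bound_transition (k l : ℕ) :
    ∃ K : ℝ, ∀ x ∈ Set.Icc (0 : ℝ) 2, ∀ z ∈ Set.Icc (0 : ℝ) 1, ∀ h ∈ Set.Icc (0 : ℝ) 1,
      |(2 + 2 * h - x) * ((x + h) ^ k * z ^ l) + x * ((x + 2 * h) ^ k * (z + h) ^ l) -
        ((2 + (2 + k) * h) * (x ^ k * z ^ l) + h * (2 * k * (x ^ (k - 1) * z ^ l)) +
          h * (l * (x ^ (k + 1) * z ^ (l - 1))))| ≤ K * h ^ 2 := by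
  obtain ⟨p, hp, hk⟩ := exists_continuous_add_pow_expansion k
  obtain ⟨q, hq, hl⟩ := exists_continuous_add_pow_expansion l
  let Q : ℝ × ℝ × ℝ → ℝ := fun u =>
    2 * k * u.1 ^ (k - 1) * u.2.1 ^ l +
    (2 + 2 * u.2.2 - u.1) * p (u.1, u.2.2) * u.2.1 ^ l +
    u.1 * (u.1 ^ k + 2 * k * u.1 ^ (k - 1) * u.2.2) * q (u.2.1, u.2.2) +
    u.1 * (2 * k * u.1 ^ (k - 1)) * (l * u.2.1 ^ (l - 1)) +
    u.1 * 4 * p (u.1, 2 * u.2.2) * (u.2.1 + u.2.2) ^ l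
  have hQ : Continuous Q := by fun_prop
  obtain ⟨K, hK⟩ := ((isCompact_Icc (a := (0 : ℝ)) (b := 2)).prod
    ((isCompact_Icc (a := (0 : ℝ)) (b := 1)).prod
      (isCompact_Icc (a := (0 : ℝ)) (b := 1)))).exists_bound_of_continuousOn hQ.continuousOn
  refine ⟨K, fun x hx z hz h hh => ?_⟩
  have hb := hK (x, z, h) ⟨hx, hz, hh⟩
  rw [Real.norm_eq_abs] at hb
  have hkx : (k : ℝ) * x ^ k = k * x ^ (k - 1) * x := by
    rcases k with _ | k
    · simp
    · simp [pow_succ, mul_assoc]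
  calc _ = |h ^ 2 * Q (x, z, h)| := by
        congr 1
        have e : (x + 2 * h) ^ k * (z + h) ^ l =
            (x ^ k + 2 * k * x ^ (k - 1) * h) * (z ^ l + l * z ^ (l - 1) * h + h ^ 2 * q (z, h)) +
            4 * h ^ 2 * p (x, 2 * h) * (z + h) ^ l := by
          rw [hk x (2 * h), ← hl z h]; ring
        rw [e, hk x h]
        simp only [Q]
        linear_combination (-(h * z ^ l)) * hkx
    _ = |Q (x, z, h)| * h ^ 2 := by rw [abs_mul, abs_of_nonneg (sq_nonneg h), mul_comm]
    _ ≤ _ := by gcongr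

lemma tendsto_zero_of_affine_recursion {u : ℕ → ℝ} {α : ℝ} (hα : 0 < α)
    (hu : Tendsto (fun n : ℕ => n * (u (n + 1) - u n) + α * u n) atTop (nhds 0)) :
    Tendsto u atTop (nhds 0) := by
  rw [Metric.tendsto_atTop]
  intro δ hδ
  obtain ⟨N₀, hN₀⟩ := Metric.tendsto_atTop.1 hu (α * (δ / 2)) (by positivity)
  obtain ⟨N₁, hN₁⟩ := exists_nat_gt α
  let N := max (max N₀ N₁) 1
  have step : ∀ n ≥ N, |u (n + 1)| - δ / 2 ≤ (1 - α / n) * (|u n| - δ / 2) := by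
    intro n hn
    have hn1 : (1 : ℝ) ≤ n := by exact_mod_cast (le_max_right _ _).trans hn
    have hnα : α ≤ n := hN₁.le.trans (by
      exact_mod_cast ((le_max_right N₀ N₁).trans (le_max_left _ _)).trans hn)
    have h := hN₀ n (((le_max_left N₀ N₁).trans (le_max_left _ _)).trans hn)
    rw [Real.dist_eq, sub_zero] at h
    set ε := (n : ℝ) * (u (n + 1) - u n) + α * u n with hε
    have hpos : (0 : ℝ) < n := by linarith
    have e : u (n + 1) = (1 - α / n) * u n + ε / n := by
      rw [hε]; field_simp; ring
    have h0 : 0 ≤ 1 - α / n := by rw [sub_nonneg, div_le_one hpos]; exact hnα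
    calc |u (n + 1)| - δ / 2 ≤ |(1 - α / n) * u n| + |ε / n| - δ / 2 := by
          rw [e]; gcongr; exact abs_add_le _ _
      _ = (1 - α / n) * |u n| + |ε| / n - δ / 2 := by
          rw [abs_mul, abs_of_nonneg h0, abs_div, abs_of_pos hpos]
      _ ≤ (1 - α / n) * |u n| + α * (δ / 2) / n - δ / 2 := by gcongr
      _ = _ := by ring
  have hprod : ∀ j, |u (N + j)| - δ / 2 ≤
      Real.exp (-α * ∑ i ∈ Finset.range j, 1 / ((N + i : ℕ) : ℝ)) * |u N| := by
    intro j
    induction j with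
    | zero => simp; linarith
    | succ j ih =>
      have hs := step (N + j) (by omega)
      have hpos : (0 : ℝ) < ((N + j : ℕ) : ℝ) := by
        exact_mod_cast lt_of_lt_of_le (lt_of_lt_of_le one_pos (le_max_right _ _)) (N.le_add_right j)
      have hnα : α ≤ ((N + j : ℕ) : ℝ) := hN₁.le.trans (by
        exact_mod_cast ((le_max_right N₀ N₁).trans (le_max_left _ 1)).trans (N.le_add_right j))
      have h0 : 0 ≤ 1 - α / ((N + j : ℕ) : ℝ) := by
        rw [sub_nonneg, div_le_one hpos]; exact hnα
      have h1 : 1 - α / ((N + j : ℕ) : ℝ) ≤ Real.exp (-(α / ((N + j : ℕ) : ℝ))) := by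
        have := Real.add_one_le_exp (-(α / ((N + j : ℕ) : ℝ)))
        linarith
      calc |u (N + (j + 1))| - δ / 2 ≤ _ := hs
        _ ≤ (1 - α / ((N + j : ℕ) : ℝ)) *
            (Real.exp (-α * ∑ i ∈ Finset.range j, 1 / ((N + i : ℕ) : ℝ)) * |u N|) := by gcongr
        _ ≤ Real.exp (-(α / ((N + j : ℕ) : ℝ))) *
            (Real.exp (-α * ∑ i ∈ Finset.range j, 1 / ((N + i : ℕ) : ℝ)) * |u N|) := by gcongr
        _ = _ := by
          rw [← mul_assoc, ← Real.exp_add, Finset.sum_range_succ]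
          congr 2
          ring
  have hdiv : Tendsto (fun j => ∑ i ∈ Finset.range j, 1 / ((N + i : ℕ) : ℝ)) atTop atTop := by
    have h := (tendsto_atTop_add_const_right atTop (-∑ i ∈ Finset.range N, 1 / (i : ℝ))
      (((not_summable_iff_tendsto_nat_atTop_of_nonneg fun i => by positivity).1
        Real.not_summable_one_div_natCast).comp (tendsto_add_atTop_nat N)))
    refine h.congr fun j => ?_
    simp only [Function.comp]
    rw [add_comm j N, Finset.sum_range_add]
    ring
  have hexp : Tendsto (fun j =>
      Real.exp (-α * ∑ i ∈ Finset.range j, 1 / ((N + i : ℕ) : ℝ)) * |u N|) atTop (nhds 0) := by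
    have := (Real.tendsto_exp_atBot.comp
      (hdiv.const_mul_atTop_of_neg (neg_lt_zero.2 hα))).mul_const |u N|
    simpa using this
  obtain ⟨J, hJ⟩ := (hexp.eventually (gt_mem_nhds (half_pos hδ))).exists_forall_of_atTop
  refine ⟨N + J, fun n hn => ?_⟩
  obtain ⟨j, rfl⟩ : ∃ j, n = N + j := ⟨n - N, by omega⟩
  rw [Real.dist_eq, sub_zero]
  have h1 := hprod j
  have h2 := hJ j (by omega)
  linarith

lemma tendsto_of_affine_recursion {u : ℕ → ℝ} {α β : ℝ} (hα : 0 < α)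
    (hu : Tendsto (fun n : ℕ => n * (u (n + 1) - u n) + α * u n) atTop (nhds β)) :
    Tendsto u atTop (nhds (β / α)) := by
  have h : Tendsto (fun n => u n - β / α) atTop (nhds 0) := by
    refine tendsto_zero_of_affine_recursion hα ?_
    have h2 := hu.sub_const β
    rw [sub_self] at h2
    refine h2.congr fun n => ?_
    field_simp
    ring
  simpa using h.add_const (β / α)

lemma tendsto_mul_ratio_pow_sub_one (r : ℕ) :
    Tendsto (fun n : ℕ => (n : ℝ) * (((n : ℝ) / (n + 1)) ^ r - 1)) atTop (nhds (-r)) := by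
  have hq := tendsto_natCast_div_add_atTop (1 : ℝ)
  induction r with
  | zero => simp
  | succ r ih =>
    have h := ih.sub ((hq.pow r).mul hq)
    have e : -((r + 1 : ℕ) : ℝ) = -r - 1 ^ r * 1 := by push_cast; ring
    rw [e]
    refine h.congr fun n => ?_
    have : (n : ℝ) + 1 ≠ 0 := by positivity
    rw [pow_succ]
    field_simp
    ring

section Functional

variable {T : ℕ → (ℕ → ℕ → ℝ) →ₗ[ℝ] ℝ} (hT0 : ∀ g, T 0 g = g 0 0)
  (hT : ∀ n g, T (n + 1) g =
    T n (fun a b => (2 * n + 1 - a) * g (a + 1) b + a * g (a + 2) (b + 1)) +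
      ∑ i ∈ Finset.range (n + 1), T i (fun _ b' => T (n - i) (fun a b => g (a + 1) (b + b'))))

include hT0 hT

lemma functional_nonneg (n : ℕ) :
    ∀ g : ℕ → ℕ → ℝ, (∀ a ≤ 2 * n, ∀ b ≤ n, 0 ≤ g a b) → 0 ≤ T n g := by
  induction n using Nat.strong_induction_on with
  | _ n ih =>
    intro g hg
    rcases n with _ | n
    · rw [hT0]; exact hg 0 le_rfl 0 le_rfl
    · rw [hT]
      refine add_nonneg (ih n n.lt_succ_self _ fun a ha b hb => ?_)
        (Finset.sum_nonneg fun i hi => ?_)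
      · have h : (a : ℝ) ≤ 2 * n := by exact_mod_cast ha
        exact add_nonneg (mul_nonneg (by linarith) (hg _ (by omega) _ (by omega)))
          (mul_nonneg a.cast_nonneg (hg _ (by omega) _ (by omega)))
      · rw [Finset.mem_range] at hi
        exact ih i hi _ fun _ _ b' hb' => ih (n - i) (by omega) _ fun a ha b hb =>
          hg _ (by omega) _ (by omega)

lemma functional_mono {n : ℕ} {g g' : ℕ → ℕ → ℝ}
    (h : ∀ a ≤ 2 * n, ∀ b ≤ n, g a b ≤ g' a b) : T n g ≤ T n g' := by
  rw [← sub_nonneg, ← map_sub]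
  exact functional_nonneg hT0 hT n _ fun a ha b hb => sub_nonneg.2 (h a ha b hb)

lemma functional_congr {n : ℕ} {g g' : ℕ → ℕ → ℝ}
    (h : ∀ a ≤ 2 * n, ∀ b ≤ n, g a b = g' a b) : T n g = T n g' :=
  le_antisymm (functional_mono hT0 hT fun a ha b hb => (h a ha b hb).le)
    (functional_mono hT0 hT fun a ha b hb => (h a ha b hb).ge)

omit hT0 hT in
lemma functional_const (n : ℕ) (c : ℝ) : T n (fun _ _ => c) = c * T n (fun _ _ => 1) := by
  rw [← smul_eq_mul, ← map_smul]
  congr 1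
  funext a b
  simp

lemma abs_functional_le {n : ℕ} {g : ℕ → ℕ → ℝ} {B : ℝ}
    (h : ∀ a ≤ 2 * n, ∀ b ≤ n, |g a b| ≤ B) : |T n g| ≤ B * T n (fun _ _ => 1) := by
  rw [abs_le, ← neg_mul, ← functional_const, ← functional_const]
  exact ⟨functional_mono hT0 hT fun a ha b hb => (abs_le.1 (h a ha b hb)).1,
    functional_mono hT0 hT fun a ha b hb => (abs_le.1 (h a ha b hb)).2⟩

lemma functional_mass {m : ℕ → ℕ} (hm0 : m 0 = 1)
    (hm : ∀ n : ℕ, m (n + 1) =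
      (∑ k ∈ Finset.range (n + 1), m k * m (n - k)) + (2 * (n + 1) - 1) * m n) (n : ℕ) :
    T n (fun _ _ => 1) = m n := by
  induction n using Nat.strong_induction_on with
  | _ n ih =>
    rcases n with _ | n
    · rw [hT0, hm0, Nat.cast_one]
    · have h1 : (fun (a _ : ℕ) => (2 * (n : ℝ) + 1 - a) * 1 + a * 1) =
          fun _ _ => 2 * (n : ℝ) + 1 := by
        funext a b; ring
      rw [hT, hm, show 2 * (n + 1) - 1 = 2 * n + 1 by omega, h1, functional_const,
        ih n n.lt_succ_self]
      push_cast
      rw [add_comm]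
      congr 1
      refine Finset.sum_congr rfl fun i hi => ?_
      rw [Finset.mem_range] at hi
      rw [functional_const, ih i hi, ih (n - i) (by omega), mul_comm]

variable {m : ℕ → ℕ} (hmass : ∀ n, T n (fun _ _ => 1) = m n)
include hmass

lemma abs_functional_convolution_le {n : ℕ} (k l : ℕ) :
    |∑ i ∈ Finset.Ico 1 n, T i (fun _ b' => T (n - i) (fun a b =>
      (((a + 1 : ℕ) : ℝ) / n) ^ k * (((b + b' : ℕ) : ℝ) / n) ^ l))| ≤
      2 ^ k * ((∑ i ∈ Finset.Ico 1 n, m i * m (n - i) : ℕ) : ℝ) := by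
  push_cast
  rw [Finset.mul_sum]
  refine (Finset.abs_sum_le_sum_abs _ _).trans (Finset.sum_le_sum fun i hi => ?_)
  rw [Finset.mem_Ico] at hi
  have hn : (0 : ℝ) < n := by exact_mod_cast (by omega : 0 < n)
  rw [mul_comm (m i : ℝ), ← mul_assoc, ← hmass i, ← hmass (n - i)]
  refine abs_functional_le hT0 hT fun _ _ b' hb' => abs_functional_le hT0 hT fun a ha b hb => ?_
  rw [abs_of_nonneg (by positivity), ← mul_one (2 ^ k)]
  gcongr
  · rw [div_le_iff₀ hn]
    exact_mod_cast (by omega : a + 1 ≤ 2 * n)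
  · refine pow_le_one₀ (by positivity) ?_
    rw [div_le_one hn]
    exact_mod_cast (by omega : b + b' ≤ n)

lemma exists_bound_moment_recursion (hm0 : m 0 = 1)
    (hm : ∀ n : ℕ, m (n + 1) =
      (∑ k ∈ Finset.range (n + 1), m k * m (n - k)) + (2 * (n + 1) - 1) * m n) (k l : ℕ) :
    ∃ K : ℝ, ∀ n : ℕ, 1 ≤ n →
      |T (n + 1) (fun a b => ((a : ℝ) / n) ^ k * ((b : ℝ) / n) ^ l) -
        ((2 * n + 2 + k) * T n (fun a b => ((a : ℝ) / n) ^ k * ((b : ℝ) / n) ^ l) +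
          2 * k * T n (fun a b => ((a : ℝ) / n) ^ (k - 1) * ((b : ℝ) / n) ^ l) +
          l * T n (fun a b => ((a : ℝ) / n) ^ (k + 1) * ((b : ℝ) / n) ^ (l - 1)) +
          (1 / (n : ℝ)) ^ k * T n (fun a b => ((a : ℝ) / n) ^ 0 * ((b : ℝ) / n) ^ l))| ≤
      K / n * m n := by
  obtain ⟨K, hK⟩ := exists_bound_transition k l
  refine ⟨K + 2 ^ k * 9, fun n hn => ?_⟩
  have hn0 : (0 : ℝ) < n := by exact_mod_cast hn
  have hconv : ((∑ i ∈ Finset.Ico 1 n, m i * m (n - i) : ℕ) : ℝ) ≤ 9 / n * m n := by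
    have h : ((2 * n + 1 : ℝ)) * ((∑ i ∈ Finset.Ico 1 n, m i * m (n - i) : ℕ) : ℝ) ≤
        9 * m n := by
      exact_mod_cast mapCount_convolution_le hm0 hm n
    rw [div_mul_eq_mul_div, le_div_iff₀ hn0]
    refine le_trans ?_ h
    rw [mul_comm]
    gcongr
    linarith
  have hmid := abs_functional_convolution_le hT0 hT hmass (n := n) k l
  rw [hT, sum_range_succ_eq_ends _ hn]
  simp only [hT0, Nat.sub_zero, Nat.sub_self]
  set mid := ∑ i ∈ Finset.Ico 1 n, T i (fun _ b' => T (n - i) (fun a b =>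
      (((a + 1 : ℕ) : ℝ) / n) ^ k * (((b + b' : ℕ) : ℝ) / n) ^ l))
  have hlast : T n (fun _ b' => (((0 + 1 : ℕ) : ℝ) / n) ^ k * (((0 + b' : ℕ) : ℝ) / n) ^ l) =
      (1 / (n : ℝ)) ^ k * T n (fun a b => ((a : ℝ) / n) ^ 0 * ((b : ℝ) / n) ^ l) := by
    rw [← smul_eq_mul, ← map_smul]
    congr 1
    funext a b
    simp
  rw [hlast]
  have hmain : |T n (fun a b => (2 * n + 1 - a) *
        ((((a + 1 : ℕ) : ℝ) / n) ^ k * ((b : ℝ) / n) ^ l) +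
          a * ((((a + 2 : ℕ) : ℝ) / n) ^ k * (((b + 1 : ℕ) : ℝ) / n) ^ l)) +
      T n (fun a b => (((a + 1 : ℕ) : ℝ) / n) ^ k * (((b + 0 : ℕ) : ℝ) / n) ^ l) -
      ((2 * n + 2 + k) * T n (fun a b => ((a : ℝ) / n) ^ k * ((b : ℝ) / n) ^ l) +
          2 * k * T n (fun a b => ((a : ℝ) / n) ^ (k - 1) * ((b : ℝ) / n) ^ l) +
          l * T n (fun a b => ((a : ℝ) / n) ^ (k + 1) * ((b : ℝ) / n) ^ (l - 1)))| ≤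
      K / n * m n := by
    simp only [← smul_eq_mul (_ : ℝ) (T _ _), ← map_smul, ← map_add, ← map_sub]
    rw [← hmass]
    refine abs_functional_le hT0 hT fun a ha b hb => ?_
    have h := hK (a / n)
      ⟨by positivity, by rw [div_le_iff₀ hn0]; exact_mod_cast ha⟩ (b / n)
      ⟨by positivity, by rw [div_le_one hn0]; exact_mod_cast hb⟩ (1 / n)
      ⟨by positivity, by rw [div_le_one hn0]; exact_mod_cast hn⟩
    have h2 := mul_le_mul_of_nonneg_left h hn0.le
    rw [← abs_of_pos hn0, ← abs_mul, abs_of_pos hn0] at h2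
    refine (le_of_eq ?_).trans (h2.trans_eq ?_)
    · congr 1
      simp only [Pi.add_apply, Pi.sub_apply, Pi.smul_apply, smul_eq_mul, add_zero]
      have e1 : (((a + 1 : ℕ) : ℝ) / n) = a / n + 1 / n := by push_cast; ring
      have e2 : (((a + 2 : ℕ) : ℝ) / n) = a / n + 2 * (1 / n) := by push_cast; ring
      have e3 : (((b + 1 : ℕ) : ℝ) / n) = b / n + 1 / n := by push_cast; ring
      rw [e1, e2, e3]
      have c1 : (n : ℝ) * (a / n) = a := by field_simp
      have c2 : (n : ℝ) * (1 / n) = 1 := by field_simp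
      generalize (a : ℝ) / n = x at *
      generalize (1 : ℝ) / n = δ at *
      generalize (b : ℝ) / n = z at *
      rw [← c1]
      generalize (x + δ) ^ k * z ^ l = P
      generalize (x + 2 * δ) ^ k * (z + δ) ^ l = P'
      generalize x ^ k * z ^ l = R
      generalize x ^ (k - 1) * z ^ l = R'
      generalize x ^ (k + 1) * z ^ (l - 1) = R''
      linear_combination (-2 * P + (2 + k) * R + 2 * k * R' + l * R'') * c2
    · field_simp
  set A := T n (fun a b => (2 * n + 1 - a) *
        ((((a + 1 : ℕ) : ℝ) / n) ^ k * ((b : ℝ) / n) ^ l) +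
          a * ((((a + 2 : ℕ) : ℝ) / n) ^ k * (((b + 1 : ℕ) : ℝ) / n) ^ l))
  calc _ = |_ + mid| := by congr 1; ring
    _ ≤ _ := abs_add_le _ _
    _ ≤ K / n * m n + 2 ^ k * (9 / n * m n) := add_le_add hmain (hmid.trans (by gcongr))
    _ = _ := by ring

end Functional

lemma tendsto_of_rational_recursion {u G ρ : ℕ → ℝ} {s B g : ℝ} {r : ℕ}
    (hρ0 : ∀ n, ρ n ≠ 0) (hρ : Tendsto (fun n : ℕ => n * ρ n) atTop (nhds (1 / 2)))
    (hδ : Tendsto (fun n : ℕ => (ρ n)⁻¹ - (2 * n + 3)) atTop (nhds 0))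
    (hu : ∀ n, |u n| ≤ B) (hG : Tendsto G atTop (nhds g)) (hpos : 0 < 2 * r + 3 - s)
    (hrec : ∀ᶠ n : ℕ in atTop,
      u (n + 1) = ((n : ℝ) / (n + 1)) ^ r * ρ n * ((2 * n + s) * u n + G n)) :
    Tendsto u atTop (nhds (g / (2 * r + 3 - s))) := by
  have hq : Tendsto (fun n : ℕ => ((n : ℝ) / (n + 1)) ^ r) atTop (nhds 1) := by
    simpa using (tendsto_natCast_div_add_atTop (1 : ℝ)).pow r
  have hcoef : Tendsto (fun n : ℕ => ((n : ℝ) / (n + 1)) ^ r * (n * ρ n) *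
      (s - 3 - ((ρ n)⁻¹ - (2 * n + 3))) + n * (((n : ℝ) / (n + 1)) ^ r - 1) +
        (2 * r + 3 - s) / 2) atTop (nhds 0) := by
    have h := (((hq.mul hρ).mul (hδ.const_sub (s - 3))).add
      (tendsto_mul_ratio_pow_sub_one r)).add_const ((2 * r + 3 - s) / 2)
    convert h using 2
    ring
  have hbdd : IsBoundedUnder (· ≤ ·) atTop (norm ∘ u) :=
    isBoundedUnder_of ⟨B, fun n => hu n⟩
  have h1 := (hcoef.zero_mul_isBoundedUnder_le hbdd).add ((hq.mul hρ).mul hG)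
  have h2 : Tendsto u atTop (nhds ((0 + 1 * (1 / 2) * g) / ((2 * r + 3 - s) / 2))) := by
    refine tendsto_of_affine_recursion (by positivity) (h1.congr' ?_)
    filter_upwards [hrec] with n hn
    rw [hn]
    field_simp [hρ0 n]
    ring
  convert h2 using 2
  field_simp
  ring

section MapCountLimits

variable {m : ℕ → ℕ} (hm0 : m 0 = 1)
  (hm : ∀ n : ℕ, m (n + 1) =
      (∑ k ∈ Finset.range (n + 1), m k * m (n - k)) + (2 * (n + 1) - 1) * m n)
include hm0 hm

lemma tendsto_mapCount_ratio_sub :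
    Tendsto (fun n : ℕ => ((m n : ℝ) / m (n + 1))⁻¹ - (2 * n + 3)) atTop (nhds 0) := by
  have hlim : Tendsto (fun n : ℕ => (9 : ℝ) / n) atTop (nhds 0) :=
    tendsto_const_div_atTop_nhds_zero_nat 9
  have key : ∀ᶠ n : ℕ in atTop, ((m n : ℝ) / m (n + 1))⁻¹ - (2 * n + 3) =
      ((∑ k ∈ Finset.Ico 1 n, m k * m (n - k) : ℕ) : ℝ) / m n := by
    filter_upwards [eventually_ge_atTop 1] with n hn
    have hp : (m n : ℝ) ≠ 0 := by exact_mod_cast (mapCount_pos hm0 hm n).ne'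
    rw [inv_div, mapCount_succ hm0 hm hn]
    push_cast
    field_simp
    ring
  refine squeeze_zero' ?_ ?_ hlim
  · filter_upwards [key] with n hn
    rw [hn]; positivity
  · filter_upwards [key, eventually_ge_atTop 1] with n hn hn1
    have hp : (0 : ℝ) < m n := by exact_mod_cast mapCount_pos hm0 hm n
    have hn0 : (0 : ℝ) < n := by exact_mod_cast hn1
    have h : ((2 * n + 1 : ℝ)) * ((∑ i ∈ Finset.Ico 1 n, m i * m (n - i) : ℕ) : ℝ) ≤
        9 * m n := by
      exact_mod_cast mapCount_convolution_le hm0 hm n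
    rw [hn, div_le_div_iff₀ hp hn0]
    refine le_trans ?_ h
    rw [mul_comm]
    gcongr
    linarith

lemma tendsto_mul_mapCount_ratio :
    Tendsto (fun n : ℕ => (n : ℝ) * ((m n : ℝ) / m (n + 1))) atTop (nhds (1 / 2)) := by
  have h1 : Tendsto (fun n : ℕ => (3 : ℝ) / n) atTop (nhds 0) :=
    tendsto_const_div_atTop_nhds_zero_nat 3
  have h2 := ((tendsto_mapCount_ratio_sub hm0 hm).mul
    (tendsto_const_div_atTop_nhds_zero_nat (1 : ℝ))).add (h1.const_add 2)
  have h3 := h2.inv₀ (by norm_num)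
  norm_num at h3 ⊢
  refine h3.congr' ?_
  filter_upwards [eventually_ge_atTop 1] with n hn
  have hn0 : (n : ℝ) ≠ 0 := by exact_mod_cast (by omega : n ≠ 0)
  have hp : (m n : ℝ) ≠ 0 := by exact_mod_cast (mapCount_pos hm0 hm n).ne'
  have hp' : (m (n + 1) : ℝ) ≠ 0 := by exact_mod_cast (mapCount_pos hm0 hm (n + 1)).ne'
  have e : ((m (n + 1) : ℝ) / m n - (2 * n + 3)) * (n : ℝ)⁻¹ + (2 + 3 / n) =
      m (n + 1) / m n / n := by
    field_simp; ring
  rw [e]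
  field_simp

end MapCountLimits

section Moments

variable {T : ℕ → (ℕ → ℕ → ℝ) →ₗ[ℝ] ℝ} (hT0 : ∀ g, T 0 g = g 0 0)
  (hT : ∀ n g, T (n + 1) g =
    T n (fun a b => (2 * n + 1 - a) * g (a + 1) b + a * g (a + 2) (b + 1)) +
      ∑ i ∈ Finset.range (n + 1), T i (fun _ b' => T (n - i) (fun a b => g (a + 1) (b + b'))))
  {m : ℕ → ℕ} (hm0 : m 0 = 1)
  (hm : ∀ n : ℕ, m (n + 1) =
      (∑ k ∈ Finset.range (n + 1), m k * m (n - k)) + (2 * (n + 1) - 1) * m n)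
include hT0 hT hm0 hm

lemma abs_moment_le (n k l : ℕ) :
    |T n (fun a b => ((a : ℝ) / n) ^ k * ((b : ℝ) / n) ^ l) / m n| ≤ 2 ^ k := by
  have hp : (0 : ℝ) < m n := by exact_mod_cast mapCount_pos hm0 hm n
  rw [abs_div, abs_of_pos hp, div_le_iff₀ hp, ← functional_mass hT0 hT hm0 hm]
  refine abs_functional_le hT0 hT fun a ha b hb => ?_
  rw [abs_of_nonneg (by positivity), ← mul_one (2 ^ k)]
  gcongr
  · exact div_le_of_le_mul₀ (by positivity) (by norm_num) (by exact_mod_cast ha)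
  · exact pow_le_one₀ (by positivity)
      (div_le_one_of_le₀ (by exact_mod_cast hb) (by positivity))

lemma tendsto_moment_of_tendsto {k l : ℕ} (hkl : ¬(k = 0 ∧ l = 0)) {c c' : ℝ}
    (hc : k ≠ 0 → Tendsto (fun n : ℕ =>
      T n (fun a b => ((a : ℝ) / n) ^ (k - 1) * ((b : ℝ) / n) ^ l) / m n) atTop (nhds c))
    (hc' : l ≠ 0 → Tendsto (fun n : ℕ =>
      T n (fun a b => ((a : ℝ) / n) ^ (k + 1) * ((b : ℝ) / n) ^ (l - 1)) / m n) atTop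
        (nhds c')) :
    Tendsto (fun n : ℕ => T n (fun a b => ((a : ℝ) / n) ^ k * ((b : ℝ) / n) ^ l) / m n) atTop
      (nhds ((2 * k * c + l * c') / (k + 2 * l + if 0 < k then 1 else 0))) := by
  have hmass := functional_mass hT0 hT hm0 hm
  obtain ⟨K, hK⟩ := exists_bound_moment_recursion hT0 hT hmass hm0 hm k l
  have hp (n) : (m n : ℝ) ≠ 0 := by exact_mod_cast (mapCount_pos hm0 hm n).ne'
  let E : ℕ → ℕ → ℕ → ℝ := fun k l n =>
    T n (fun a b => ((a : ℝ) / n) ^ k * ((b : ℝ) / n) ^ l) / m n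
  let ε : ℕ → ℝ := fun n =>
    T (n + 1) (fun a b => ((a : ℝ) / n) ^ k * ((b : ℝ) / n) ^ l) / m n -
      ((2 * n + 2 + k) * E k l n + 2 * k * E (k - 1) l n + l * E (k + 1) (l - 1) n +
        (1 / (n : ℝ)) ^ k * E 0 l n)
  have hε : Tendsto ε atTop (nhds 0) := by
    refine squeeze_zero_norm' ?_ (tendsto_const_div_atTop_nhds_zero_nat K)
    filter_upwards [eventually_ge_atTop 1] with n hn
    have hp' : (0 : ℝ) < m n := by exact_mod_cast mapCount_pos hm0 hm n
    rw [← mul_le_mul_iff_left₀ hp']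
    refine le_trans (le_of_eq ?_) (hK n hn)
    rw [Real.norm_eq_abs, ← abs_of_pos hp', ← abs_mul]
    congr 1
    simp only [ε, E]
    field_simp [hp n]
  have hlow : Tendsto (fun n : ℕ => if k = 0 then 0 else (1 / (n : ℝ)) ^ k * E 0 l n) atTop
      (nhds 0) := by
    split_ifs with hk
    · exact tendsto_const_nhds
    · have h0 : Tendsto (fun n : ℕ => (1 / (n : ℝ)) ^ k) atTop (nhds 0) := by
        simpa [hk] using (tendsto_const_div_atTop_nhds_zero_nat (1 : ℝ)).pow k
      exact h0.zero_mul_isBoundedUnder_le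
        (isBoundedUnder_of ⟨2 ^ 0, fun n => abs_moment_le hT0 hT hm0 hm n 0 l⟩)
  have hc1 : Tendsto (fun n => 2 * k * E (k - 1) l n) atTop (nhds (2 * k * c)) := by
    rcases eq_or_ne k 0 with rfl | hk
    · simp
    · exact (hc hk).const_mul _
  have hc2 : Tendsto (fun n => l * E (k + 1) (l - 1) n) atTop (nhds (l * c')) := by
    rcases eq_or_ne l 0 with rfl | hl
    · simp
    · exact (hc' hl).const_mul _
  have hG := ((hc1.add hc2).add hlow).add hε
  have hcoef : (2 * ((k + l : ℕ) : ℝ) + 3 - (2 + k + if k = 0 then 1 else 0)) =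
      k + 2 * l + if 0 < k then 1 else 0 := by
    push_cast
    rcases Nat.eq_zero_or_pos k with rfl | hk
    · simp; ring
    · simp [hk, hk.ne']; ring
  have hpos : (0 : ℝ) < k + 2 * l + if 0 < k then 1 else 0 := by
    rcases Nat.eq_zero_or_pos k with rfl | hk
    · have : 0 < l := by omega
      simp [this]
    · simp only [hk, if_true]; positivity
  have hmain := tendsto_of_rational_recursion (u := E k l) (r := k + l)
    (s := 2 + k + if k = 0 then 1 else 0)
    (fun n => div_ne_zero (hp n) (hp (n + 1)))
    (tendsto_mul_mapCount_ratio hm0 hm) (tendsto_mapCount_ratio_sub hm0 hm)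
    (fun n => abs_moment_le hT0 hT hm0 hm n k l) hG (by rw [hcoef]; exact hpos) (by
      filter_upwards [eventually_ge_atTop 1] with n hn
      have hn0 : (n : ℝ) ≠ 0 := by exact_mod_cast (by omega : n ≠ 0)
      have hn1 : (n : ℝ) + 1 ≠ 0 := by positivity
      have hscale : T (n + 1) (fun a b =>
          ((a : ℝ) / (n + 1 : ℕ)) ^ k * ((b : ℝ) / (n + 1 : ℕ)) ^ l) =
          ((n : ℝ) / (n + 1)) ^ (k + l) *
            T (n + 1) (fun a b => ((a : ℝ) / n) ^ k * ((b : ℝ) / n) ^ l) := by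
        rw [← smul_eq_mul, ← map_smul]
        congr 1
        funext a b
        simp only [Pi.smul_apply, smul_eq_mul]
        have ea (x : ℝ) : x / (n + 1 : ℕ) = n / (n + 1) * (x / n) := by
          push_cast; field_simp
        rw [ea, ea, mul_pow, mul_pow, pow_add]
        ring
      have hsum : (2 * n + (2 + k + if k = 0 then 1 else 0)) * E k l n +
          (2 * k * E (k - 1) l n + l * E (k + 1) (l - 1) n +
            (if k = 0 then 0 else (1 / (n : ℝ)) ^ k * E 0 l n) + ε n) =
          T (n + 1) (fun a b => ((a : ℝ) / n) ^ k * ((b : ℝ) / n) ^ l) / m n := by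
        simp only [ε]
        rcases eq_or_ne k 0 with rfl | hk
        · simp; ring
        · simp only [hk, if_false]; ring
      rw [hsum]
      change T (n + 1) (fun a b =>
          ((a : ℝ) / (n + 1 : ℕ)) ^ k * ((b : ℝ) / (n + 1 : ℕ)) ^ l) / m (n + 1) = _
      rw [hscale]
      field_simp [hp n, hp (n + 1)])
  rw [hcoef] at hmain
  simpa using hmain

lemma tendsto_moment {η : ℕ → ℕ → ℝ} (hη0 : η 0 0 = 2)
    (hη : ∀ k ℓ : ℕ, ¬(k = 0 ∧ ℓ = 0) →
      η k ℓ = (2 * (k : ℝ) * η (k - 1) ℓ + (ℓ : ℝ) * η (k + 1) (ℓ - 1)) /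
        ((k : ℝ) + 2 * (ℓ : ℝ) + if 0 < k then 1 else 0)) (l k : ℕ) :
    Tendsto (fun n : ℕ => T n (fun a b => ((a : ℝ) / n) ^ k * ((b : ℝ) / n) ^ l) / m n) atTop
      (nhds (η k l / 2)) := by
  have step (k l : ℕ) (hkl : ¬(k = 0 ∧ l = 0)) : η k l / 2 =
      (2 * k * (η (k - 1) l / 2) + l * (η (k + 1) (l - 1) / 2)) /
        (k + 2 * l + if 0 < k then 1 else 0) := by
    rw [hη k l hkl]; ring
  induction l generalizing k with
  | zero =>
    induction k with
    | zero =>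
      rw [hη0, div_self two_ne_zero]
      refine tendsto_const_nhds.congr fun n => ?_
      have hp : (m n : ℝ) ≠ 0 := by exact_mod_cast (mapCount_pos hm0 hm n).ne'
      simp only [pow_zero, mul_one]
      rw [functional_mass hT0 hT hm0 hm, div_self hp]
    | succ k ih =>
      rw [step _ _ (by simp)]
      exact tendsto_moment_of_tendsto hT0 hT hm0 hm (by simp) (fun _ => ih) (by simp)
  | succ l ihl =>
    induction k with
    | zero =>
      rw [step _ _ (by simp)]
      exact tendsto_moment_of_tendsto hT0 hT hm0 hm (by simp) (by simp) (fun _ => ihl _)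
    | succ k ih =>
      rw [step _ _ (by simp)]
      exact tendsto_moment_of_tendsto hT0 hT hm0 hm (by simp) (fun _ => ih) (fun _ => ihl _)

end Moments

lemma probabilityMeasure_ext_of_moments {μ ν : ProbabilityMeasure (Set.Icc (0 : ℝ) 1)}
    (h : ∀ l : ℕ, ∫ x : Set.Icc (0 : ℝ) 1, (x : ℝ) ^ l ∂(μ : Measure (Set.Icc (0 : ℝ) 1)) =
      ∫ x : Set.Icc (0 : ℝ) 1, (x : ℝ) ^ l ∂(ν : Measure (Set.Icc (0 : ℝ) 1))) : μ = ν := by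
  have hint (P : Measure (Set.Icc (0 : ℝ) 1)) [IsFiniteMeasure P]
      (f : Set.Icc (0 : ℝ) 1 → ℝ) (hf : Continuous f) : Integrable f P :=
    hf.integrable_of_hasCompactSupport (HasCompactSupport.of_compactSpace f)
  have hpoly (p : Polynomial ℝ) :
      ∫ x : Set.Icc (0 : ℝ) 1, p.eval (x : ℝ) ∂(μ : Measure (Set.Icc (0 : ℝ) 1)) =
        ∫ x : Set.Icc (0 : ℝ) 1, p.eval (x : ℝ) ∂(ν : Measure (Set.Icc (0 : ℝ) 1)) := by
    simp only [Polynomial.eval_eq_sum_range]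
    rw [integral_finsetSum _ fun i _ => hint _ _ (by fun_prop),
      integral_finsetSum _ fun i _ => hint _ _ (by fun_prop)]
    refine Finset.sum_congr rfl fun i _ => ?_
    rw [integral_const_mul, integral_const_mul, h]
  apply ProbabilityMeasure.toMeasure_injective
  refine ext_of_forall_integral_eq_of_IsFiniteMeasure fun f => ?_
  refine eq_of_forall_dist_le fun ε hε => ?_
  obtain ⟨p, hp⟩ := exists_polynomial_near_continuousMap 0 1 f.toContinuousMap (ε / 2)
    (half_pos hε)
  have near (P : Measure (Set.Icc (0 : ℝ) 1)) [IsProbabilityMeasure P] :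
      |∫ x, f x ∂P - ∫ x : Set.Icc (0 : ℝ) 1, p.eval (x : ℝ) ∂P| ≤ ε / 2 := by
    rw [← integral_sub (hint _ _ f.continuous) (hint _ _ (by fun_prop)), ← Real.norm_eq_abs]
    have := norm_integral_le_of_norm_le_const (μ := P) (C := ε / 2)
      (f := fun x => f x - p.eval (x : ℝ)) (Eventually.of_forall fun x => by
        rw [norm_sub_rev]
        exact (ContinuousMap.norm_coe_le_norm (p.toContinuousMapOn _ - f.toContinuousMap) x).trans
          hp.le)
    simpa using this
  have h1 := near μ
  have h2 := near ν
  rw [hpoly] at h1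
  rw [Real.dist_eq]
  rw [abs_le] at *
  constructor <;> linarith [h1.1, h1.2, h2.1, h2.2]

/-- The method of moments on the unit interval. -/
lemma exists_tendsto_of_tendsto_moments (ν : ℕ → ProbabilityMeasure (Set.Icc (0 : ℝ) 1))
    {c : ℕ → ℝ} (h : ∀ l, Tendsto (fun n => ∫ x : Set.Icc (0 : ℝ) 1, (x : ℝ) ^ l
      ∂(ν n : Measure (Set.Icc (0 : ℝ) 1))) atTop (nhds (c l))) :
    ∃ μ : ProbabilityMeasure (Set.Icc (0 : ℝ) 1),
      (∀ l : ℕ, ∫ x : Set.Icc (0 : ℝ) 1, (x : ℝ) ^ l ∂(μ : Measure (Set.Icc (0 : ℝ) 1)) = c l) ∧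
      Tendsto ν atTop (nhds μ) := by
  have key (μ : ProbabilityMeasure (Set.Icc (0 : ℝ) 1)) (F : Ultrafilter ℕ)
      (hF : (F : Filter ℕ) ≤ atTop) (hμ : Tendsto ν F (nhds μ)) (l : ℕ) :
      ∫ x : Set.Icc (0 : ℝ) 1, (x : ℝ) ^ l ∂(μ : Measure (Set.Icc (0 : ℝ) 1)) = c l := by
    have h1 := ProbabilityMeasure.tendsto_iff_forall_integral_tendsto.1 hμ
      (BoundedContinuousFunction.mkOfCompact ⟨fun x : Set.Icc (0 : ℝ) 1 => (x : ℝ) ^ l,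
        by fun_prop⟩)
    exact tendsto_nhds_unique h1 ((h l).mono_left hF)
  have lim (F : Ultrafilter ℕ) : ∃ μ, Tendsto ν F (nhds μ) := by
    obtain ⟨μ, -, hμ⟩ := isCompact_univ.ultrafilter_le_nhds (F.map ν) (by simp)
    exact ⟨μ, hμ⟩
  obtain ⟨μ, hμ⟩ := lim (Ultrafilter.of atTop)
  have hμc := key μ _ (Ultrafilter.of_le _) hμ
  refine ⟨μ, hμc, tendsto_iff_ultrafilter _ _ _ |>.2 fun F hF => ?_⟩
  obtain ⟨μ', hμ'⟩ := lim F
  rwa [probabilityMeasure_ext_of_moments fun l => (hμc l).trans (key μ' F hF hμ' l).symm]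

section Law

variable {T : ℕ → (ℕ → ℕ → ℝ) →ₗ[ℝ] ℝ} (hT0 : ∀ g, T 0 g = g 0 0)
  (hT : ∀ n g, T (n + 1) g =
    T n (fun a b => (2 * n + 1 - a) * g (a + 1) b + a * g (a + 2) (b + 1)) +
      ∑ i ∈ Finset.range (n + 1), T i (fun _ b' => T (n - i) (fun a b => g (a + 1) (b + b'))))
include hT0 hT

lemma functional_eq_sum_indicator {n N : ℕ} (hN : n < N) (g : ℕ → ℝ) :
    T n (fun _ b => g b) =
      ∑ j ∈ Finset.range N, g j * T n (fun _ b => if b = j then 1 else 0) := by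
  simp only [← smul_eq_mul (_ : ℝ) (T _ _), ← map_smul, ← map_sum]
  refine functional_congr hT0 hT fun a _ b hb => ?_
  simp [Finset.sum_apply, show b < N by omega]

variable {m : ℕ → ℕ} (hm0 : m 0 = 1)
  (hm : ∀ n : ℕ, m (n + 1) =
      (∑ k ∈ Finset.range (n + 1), m k * m (n - k)) + (2 * (n + 1) - 1) * m n)
include hm0 hm

lemma exists_law (n : ℕ) : ∃ ν : ProbabilityMeasure (Set.Icc (0 : ℝ) 1), ∀ f : ℝ → ℝ,
    ∫ x : Set.Icc (0 : ℝ) 1, f x ∂(ν : Measure (Set.Icc (0 : ℝ) 1)) =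
      T n (fun _ b => f (b / n)) / m n := by
  have hp : (0 : ℝ) < m n := by exact_mod_cast mapCount_pos hm0 hm n
  let w : ℕ → ℝ := fun j => T n (fun _ b => if b = j then 1 else 0) / m n
  have hw (j) : 0 ≤ w j := div_nonneg
    (functional_nonneg hT0 hT n _ fun a _ b _ => by positivity) hp.le
  have hw1 : ∑ j ∈ Finset.range (n + 1), w j = 1 := by
    have h := functional_eq_sum_indicator hT0 hT n.lt_succ_self (fun _ => 1)
    simp only [one_mul] at h
    rw [← Finset.sum_div, ← h, functional_mass hT0 hT hm0 hm, div_self hp.ne']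
  let P : Measure (Set.Icc (0 : ℝ) 1) := ∑ j ∈ Finset.range (n + 1),
    ENNReal.ofReal (w j) • Measure.dirac (Set.projIcc 0 1 zero_le_one ((j : ℝ) / n))
  have hP : IsProbabilityMeasure P := by
    constructor
    simp only [P, Measure.coe_finsetSum, Finset.sum_apply, Measure.smul_apply, measure_univ,
      smul_eq_mul, mul_one]
    rw [← ENNReal.ofReal_sum_of_nonneg fun j _ => hw j, hw1, ENNReal.ofReal_one]
  refine ⟨⟨P, hP⟩, fun f => ?_⟩
  change ∫ x : Set.Icc (0 : ℝ) 1, f x ∂P = _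
  rw [integral_finsetSum_measure fun j _ =>
    (integrable_dirac (by simp)).smul_measure ENNReal.ofReal_ne_top,
    functional_eq_sum_indicator hT0 hT n.lt_succ_self (fun b => f (b / n)), Finset.sum_div]
  refine Finset.sum_congr rfl fun j hj => ?_
  have hj' : (j : ℝ) / n ∈ Set.Icc (0 : ℝ) 1 := ⟨by positivity,
    div_le_one_of_le₀ (by exact_mod_cast Finset.mem_range_succ_iff.1 hj) (by positivity)⟩
  rw [integral_smul_measure, integral_dirac, ENNReal.toReal_ofReal (hw j),
    Set.projIcc_of_mem _ hj', smul_eq_mul]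
  simp only [w]
  ring

end Law

lemma sum_coeff_setVOne_eq_coeffPairing {y : ℕ → MvPolynomial (Fin 2) ℝ}
    (hT0 : ∀ g, coeffPairing.flip (y 0) g = g 0 0)
    (hT : ∀ n g, coeffPairing.flip (y (n + 1)) g =
      coeffPairing.flip (y n)
          (fun a b => (2 * n + 1 - a) * g (a + 1) b + a * g (a + 2) (b + 1)) +
        ∑ i ∈ Finset.range (n + 1), coeffPairing.flip (y i)
          (fun _ b' => coeffPairing.flip (y (n - i)) (fun a b => g (a + 1) (b + b'))))
    (n : ℕ) (g : ℕ → ℝ) :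
    ∑ j ∈ Finset.range ((setVOne (y n)).totalDegree + 1),
        g j * coeff (Finsupp.single (1 : Fin 2) j) (setVOne (y n)) =
      coeffPairing.flip (y n) (fun _ b => g b) := by
  rw [functional_eq_sum_indicator (T := fun n => coeffPairing.flip (y n)) hT0 hT
    (N := max ((setVOne (y n)).totalDegree + 1) (n + 1)) (by simp)]
  simp only [LinearMap.flip_apply, ← coeff_setVOne]
  refine Finset.sum_subset (Finset.range_mono (le_max_left _ _)) fun j _ hj => ?_
  rw [coeff_eq_zero_of_totalDegree_lt, mul_zero]
  rw [Finset.mem_range, not_lt] at hj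
  rw [← Finsupp.degree_apply, Finsupp.degree_single]
  exact hj

/-- There exists a Borel probability measure `μ` on `[0,1]` whose `ℓ`-th
moment is `η(0,ℓ)/2` for every `ℓ ≥ 0`, and the number of loops `Y_n` of a uniform random
rooted map with `n` edges satisfies `Y_n/n → μ` in distribution: for every bounded
continuous `f : ℝ → ℝ`, `lim_{n→∞} (Σ_{j≥0} f(j/n)·y_{n,j}) / m(n) = ∫ f dμ`, where
`y_{n,j}` is the coefficient of `w^j` in `y_n(1,w)`. -/
theorem loops_limit_law
    (m : ℕ → ℕ) (hm0 : m 0 = 1)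
    (hm : ∀ n : ℕ, m (n + 1) =
      (∑ k ∈ Finset.range (n + 1), m k * m (n - k)) + (2 * (n + 1) - 1) * m n)
    (y : ℕ → MvPolynomial (Fin 2) ℝ) (hy0 : y 0 = 1)
    (hy : ∀ n : ℕ, y (n + 1) =
      X 0 * y n + C (2 * (n : ℝ)) * X 0 * y n +
        X 0 * ∑ i ∈ Finset.range (n + 1),
          (aeval (fun j : Fin 2 => if j = 0 then (1 : MvPolynomial (Fin 2) ℝ) else X 1)
              (y i)) * y (n - i) +
        X 0 ^ 2 * (X 0 * X 1 - 1) * pderiv (0 : Fin 2) (y n))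
    (Y : ℕ → MvPolynomial (Fin 2) ℝ)
    (hY : ∀ n, Y n =
      aeval (fun j : Fin 2 => if j = 0 then (1 : MvPolynomial (Fin 2) ℝ) else X 1) (y n))
    (η : ℕ → ℕ → ℝ) (hη0 : η 0 0 = 2)
    (hη : ∀ k ℓ : ℕ, ¬(k = 0 ∧ ℓ = 0) →
      η k ℓ = (2 * (k : ℝ) * η (k - 1) ℓ + (ℓ : ℝ) * η (k + 1) (ℓ - 1)) /
        ((k : ℝ) + 2 * (ℓ : ℝ) + if 0 < k then 1 else 0)) :
    ∃ μ : Measure ℝ, IsProbabilityMeasure μ ∧ μ (Set.Icc (0 : ℝ) 1)ᶜ = 0 ∧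
      (∀ ℓ : ℕ, (∫ x, x ^ ℓ ∂μ) = η 0 ℓ / 2) ∧
      ∀ f : ℝ → ℝ, Continuous f → (∃ B : ℝ, ∀ x : ℝ, |f x| ≤ B) →
        Tendsto
          (fun n : ℕ =>
            (∑ j ∈ Finset.range ((Y n).totalDegree + 1),
                f ((j : ℝ) / n) * coeff (Finsupp.single (1 : Fin 2) j) (Y n)) /
              (m n : ℝ))
          atTop (nhds (∫ x, f x ∂μ)) := by
  have hT0 (g : ℕ → ℕ → ℝ) : coeffPairing.flip (y 0) g = g 0 0 := by
    rw [hy0, LinearMap.flip_apply, coeffPairing_one]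
  have hT (n : ℕ) (g : ℕ → ℕ → ℝ) := coeffPairing_succ hy n g
  have hTm := tendsto_moment (T := fun n => coeffPairing.flip (y n)) hT0 hT hm0 hm hη0 hη
  choose ν hν using exists_law (T := fun n => coeffPairing.flip (y n)) hT0 hT hm0 hm
  obtain ⟨μ, hμ, hlim⟩ := exists_tendsto_of_tendsto_moments ν (c := fun l => η 0 l / 2)
    fun l => (hTm l 0).congr fun n => by
      rw [hν n fun x => x ^ l]
      simp
  have hmap (f : ℝ → ℝ) (hf : Continuous f) :
      ∫ x, f x ∂((μ : Measure (Set.Icc (0 : ℝ) 1)).map Subtype.val) =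
        ∫ x : Set.Icc (0 : ℝ) 1, f x ∂(μ : Measure (Set.Icc (0 : ℝ) 1)) :=
    integral_map measurable_subtype_coe.aemeasurable hf.aestronglyMeasurable
  refine ⟨(μ : Measure (Set.Icc (0 : ℝ) 1)).map Subtype.val,
    Measure.isProbabilityMeasure_map measurable_subtype_coe.aemeasurable, ?_, fun l => ?_,
    fun f hf _ => ?_⟩
  · rw [Measure.map_apply measurable_subtype_coe measurableSet_Icc.compl]
    simp
  · rw [hmap _ (continuous_pow l), hμ]
  · rw [hmap f hf]
    have h := ProbabilityMeasure.tendsto_iff_forall_integral_tendsto.1 hlim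
      (BoundedContinuousFunction.mkOfCompact
        ⟨fun x : Set.Icc (0 : ℝ) 1 => f x, hf.comp continuous_subtype_val⟩)
    refine h.congr fun n => ?_
    refine (hν n f).trans ?_
    rw [hY, ← setVOne, ← sum_coeff_setVOne_eq_coeffPairing hT0 hT n fun j => f (j / n)]
end

section
/- The mean number of loops of a uniform random rooted map with n edges is asymptotic to n/2: lim_{n→∞} (∂_w y_n)(1,1)/(n·m(n)) = 1/2. -/
open MvPolynomial Filter

namespace RootedMaps

/-- The convolution recurrence for the number of rooted maps with `n` edges. -/
def IsMapCount (m : ℕ → ℕ) : Prop :=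
  m 0 = 1 ∧ ∀ n : ℕ, m (n + 1) =
    (∑ k ∈ Finset.range (n + 1), m k * m (n - k)) + (2 * (n + 1) - 1) * m n

/-- The part of the self-convolution of `m` at `n` that omits the two end terms (for `n ≥ 1`). -/
noncomputable def excess (m : ℕ → ℕ) (n : ℕ) : ℝ :=
  (∑ k ∈ Finset.range (n + 1), (m k : ℝ) * m (n - k)) - 2 * m n

namespace IsMapCount

variable {m : ℕ → ℕ}

lemma zero (h : IsMapCount m) : m 0 = 1 := h.1

lemma succ (h : IsMapCount m) (n : ℕ) : m (n + 1) =
    (∑ k ∈ Finset.range (n + 1), m k * m (n - k)) + (2 * n + 1) * m n := by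
  rw [h.2 n, show 2 * (n + 1) - 1 = 2 * n + 1 by omega]

lemma one (h : IsMapCount m) : m 1 = 2 := by
  simp [h.succ 0, h.zero]

lemma two (h : IsMapCount m) : m 2 = 10 := by
  simp [h.succ 1, h.zero, h.one, Finset.sum_range_succ]

lemma le_succ (h : IsMapCount m) (n : ℕ) : (2 * n + 1) * m n ≤ m (n + 1) := by
  rw [h.succ n]; omega

lemma pos (h : IsMapCount m) (n : ℕ) : 0 < m n := by
  induction n with
  | zero => simp [h.zero]
  | succ n ih => exact lt_of_lt_of_le (by positivity) (h.le_succ n)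

lemma conv_add_two (h : IsMapCount m) (n : ℕ) :
    ∑ k ∈ Finset.range (n + 3), m k * m (n + 2 - k) =
      2 * m (n + 2) + ∑ k ∈ Finset.range (n + 1), m (k + 1) * m (n - k + 1) := by
  rw [Finset.sum_range_succ, Finset.sum_range_succ']
  have : ∀ k ∈ Finset.range (n + 1), m (k + 1) * m (n + 2 - (k + 1)) =
      m (k + 1) * m (n - k + 1) := by
    intro k hk
    rw [Finset.mem_range] at hk
    rw [show n + 2 - (k + 1) = n - k + 1 by omega]
  rw [Finset.sum_congr rfl this]
  simp [h.zero]
  ring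

lemma le_succ_succ (h : IsMapCount m) (n : ℕ) : (2 * n + 5) * m (n + 1) ≤ m (n + 2) := by
  rw [h.succ (n + 1), Finset.sum_range_succ, Finset.sum_range_succ']
  simp [h.zero]
  nlinarith [Nat.zero_le (∑ k ∈ Finset.range n, m (k + 1) * m (n - k))]

lemma mul_le_of_ratio_le (h : IsMapCount m) {N k : ℕ}
    (hr : ∀ i < N, m (i + 1) ≤ (2 * i + 5) * m i) (i j : ℕ) (hij : i ≤ j) (hN : k + i ≤ N) :
    m (k + i) * m (k + j) ≤ m k * m (k + i + j) := by
  induction i generalizing j with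
  | zero => simp
  | succ i ih =>
    have ih' := ih (j + 1) (by omega) (by omega)
    rw [show k + i + (j + 1) = k + (i + 1) + j by omega] at ih'
    refine le_trans ?_ ih'
    obtain ⟨t, rfl⟩ : ∃ t, j = t + 1 := ⟨j - 1, by omega⟩
    have h1 := hr (k + i) (by omega)
    have h2 := h.le_succ_succ (k + t)
    calc m (k + (i + 1)) * m (k + (t + 1))
        ≤ ((2 * (k + i) + 5) * m (k + i)) * m (k + t + 1) := Nat.mul_le_mul_right _ h1
      _ ≤ ((2 * (k + t) + 5) * m (k + i)) * m (k + t + 1) := by gcongr; omega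
      _ = m (k + i) * ((2 * (k + t) + 5) * m (k + t + 1)) := by ring
      _ ≤ m (k + i) * m (k + t + 2) := Nat.mul_le_mul_left _ h2

lemma mul_le_of_ratio_le' (h : IsMapCount m) {N k : ℕ}
    (hr : ∀ i < N, m (i + 1) ≤ (2 * i + 5) * m i) (i j : ℕ) (hN : k + i + j ≤ N) :
    m (k + i) * m (k + j) ≤ m k * m (k + i + j) := by
  rcases le_total i j with hij | hij
  · exact h.mul_le_of_ratio_le hr i j hij (by omega)
  · have := h.mul_le_of_ratio_le hr (k := k) j i hij (by omega)
    rwa [mul_comm, add_right_comm]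

lemma succ_le (h : IsMapCount m) (n : ℕ) : m (n + 1) ≤ (2 * n + 5) * m n := by
  induction n using Nat.strong_induction_on with
  | _ n ih =>
    match n, ih with
    | 0, _ => simp [h.zero, h.one]
    | 1, _ => simp [h.two, h.one]
    | n + 2, ih =>
      have hs : ∑ k ∈ Finset.range (n + 1), m (k + 1) * m (n - k + 1) ≤
          ∑ k ∈ Finset.range (n + 1), 2 * m (n + 1) := by
        refine Finset.sum_le_sum fun k hk => ?_
        rw [Finset.mem_range] at hk
        have := h.mul_le_of_ratio_le' ih (k := 1) k (n - k) (by omega)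
        rwa [h.one, show 1 + k + (n - k) = n + 1 by omega, add_comm 1 k,
          add_comm 1 (n - k)] at this
      rw [Finset.sum_const, Finset.card_range, smul_eq_mul] at hs
      have h1 := h.le_succ (n + 1)
      have h2 := h.conv_add_two n
      have h3 := h.succ (n + 2)
      rw [h2] at h3
      rw [h3]
      nlinarith

lemma mul_le (h : IsMapCount m) (k i j : ℕ) :
    m (k + i) * m (k + j) ≤ m k * m (k + i + j) :=
  h.mul_le_of_ratio_le' (N := k + i + j) (fun i _ => h.succ_le i) i j le_rfl

lemma inner_conv_le (h : IsMapCount m) (n : ℕ) :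
    ∑ k ∈ Finset.range (n + 3), m (k + 1) * m (n + 2 - k + 1) ≤ 14 * m (n + 3) := by
  rw [Finset.sum_range_succ, Finset.sum_range_succ']
  have hs : ∑ k ∈ Finset.range (n + 1), m (k + 1 + 1) * m (n + 2 - (k + 1) + 1) ≤
      ∑ k ∈ Finset.range (n + 1), 10 * m (n + 2) := by
    refine Finset.sum_le_sum fun k hk => ?_
    rw [Finset.mem_range] at hk
    have := h.mul_le 2 k (n - k)
    rwa [h.two, show 2 + k + (n - k) = n + 2 by omega, add_comm 2 k,
      show 2 + (n - k) = n + 2 - (k + 1) + 1 by omega] at this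
  rw [Finset.sum_const, Finset.card_range, smul_eq_mul] at hs
  have h1 := h.le_succ (n + 2)
  simp [h.one]
  simp at hs
  nlinarith

lemma cast_succ (h : IsMapCount m) (n : ℕ) :
    (m (n + 1) : ℝ) = (2 * n + 3) * m n + excess m n := by
  rw [h.succ n, excess]
  push_cast
  ring

lemma excess_le (h : IsMapCount m) (n : ℕ) : excess m n ≤ 2 * m n := by
  have h1 : (m (n + 1) : ℝ) ≤ (2 * n + 5) * m n := mod_cast h.succ_le n
  linarith [h.cast_succ n]

lemma excess_add_two (h : IsMapCount m) (n : ℕ) : excess m (n + 2) =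
    (∑ k ∈ Finset.range (n + 1), m (k + 1) * m (n - k + 1) : ℕ) := by
  have h1 := h.conv_add_two n
  rify at h1
  rw [excess, h1]
  push_cast
  ring

lemma mul_excess_le (h : IsMapCount m) (n : ℕ) :
    0 ≤ excess m (n + 4) ∧ ((n + 4 : ℕ) : ℝ) * excess m (n + 4) ≤ 14 * m (n + 4) := by
  rw [h.excess_add_two (n + 2)]
  refine ⟨Nat.cast_nonneg _, ?_⟩
  norm_cast
  have h1 := h.inner_conv_le n
  have h2 := h.le_succ (n + 3)
  calc _ ≤ (n + 4) * (14 * m (n + 3)) := Nat.mul_le_mul_left _ h1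
    _ ≤ 14 * ((2 * (n + 3) + 1) * m (n + 3)) := by nlinarith [Nat.zero_le (m (n + 3))]
    _ ≤ _ := Nat.mul_le_mul_left _ h2

lemma weighted_conv (n : ℕ) :
    2 * ∑ k ∈ Finset.range (n + 1), (m k : ℝ) * (((n - k : ℕ) : ℝ) * m (n - k)) =
      n * (excess m n + 2 * m n) := by
  have h1 := Finset.sum_range_reflect
    (fun k => (m k : ℝ) * (((n - k : ℕ) : ℝ) * m (n - k))) (n + 1)
  rw [two_mul]
  nth_rewrite 1 [← h1]
  rw [excess, sub_add_cancel, ← Finset.sum_add_distrib, Finset.mul_sum]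
  refine Finset.sum_congr rfl fun k hk => ?_
  rw [Finset.mem_range] at hk
  have hk' : k ≤ n := by omega
  rw [show n + 1 - 1 - k = n - k by omega, Nat.sub_sub_self hk', Nat.cast_sub hk']
  ring

lemma le_conv (h : IsMapCount m) {f : ℕ → ℝ} (hf : ∀ k, 0 ≤ f k) (n : ℕ) :
    f n ≤ ∑ k ∈ Finset.range (n + 1), (m k : ℝ) * f (n - k) := by
  have := Finset.single_le_sum (s := Finset.range (n + 1))
    (f := fun k => (m k : ℝ) * f (n - k)) (fun k _ => mul_nonneg (Nat.cast_nonneg _) (hf _))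
    (Finset.mem_range.2 n.succ_pos)
  simpa [h.zero] using this

lemma conv_le (h : IsMapCount m) {f : ℕ → ℝ} {a : ℝ} (hf : ∀ k, f k ≤ a * (k * m k)) (n : ℕ) :
    ∑ k ∈ Finset.range (n + 1), (m k : ℝ) * f (n - k) ≤ f n + a / 2 * (n * excess m n) := by
  have h1 := h.le_conv (f := fun k => a * (k * m k) - f k) (fun k => sub_nonneg.2 (hf k)) n
  have h2 : ∑ k ∈ Finset.range (n + 1),
      (m k : ℝ) * (a * (((n - k : ℕ) : ℝ) * m (n - k)) - f (n - k)) =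
      a * ∑ k ∈ Finset.range (n + 1), (m k : ℝ) * (((n - k : ℕ) : ℝ) * m (n - k)) -
      ∑ k ∈ Finset.range (n + 1), (m k : ℝ) * f (n - k) := by
    rw [Finset.mul_sum, ← Finset.sum_sub_distrib]
    exact Finset.sum_congr rfl fun k _ => by ring
  rw [h2] at h1
  have h3 := weighted_conv (m := m) n
  linear_combination h1 + a / 2 * h3

lemma conv_le_of_forall_le {f : ℕ → ℝ} {a : ℝ} {n : ℕ}
    (hf : ∀ k ≤ n, f k ≤ a * (k * m k)) :
    ∑ k ∈ Finset.range (n + 1), (m k : ℝ) * f (n - k) ≤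
      a / 2 * (n * (excess m n + 2 * m n)) := by
  rw [← weighted_conv, ← mul_assoc, div_mul_cancel₀ _ two_ne_zero, Finset.mul_sum]
  refine Finset.sum_le_sum fun k _ => ?_
  rw [mul_left_comm]
  exact mul_le_mul_of_nonneg_left (hf _ (Nat.sub_le _ _)) (Nat.cast_nonneg _)

lemma tendsto_ratio (h : IsMapCount m) :
    Tendsto (fun n : ℕ => (n : ℝ) * m n / m (n + 1)) atTop (nhds (1 / 2)) := by
  have hlim : Tendsto (fun n : ℕ => (5 : ℝ) / (n : ℝ)) atTop (nhds 0) :=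
    tendsto_const_div_atTop_nhds_zero_nat 5
  rw [tendsto_iff_dist_tendsto_zero]
  refine squeeze_zero' (.of_forall fun _ => dist_nonneg) ?_ hlim
  filter_upwards [eventually_ge_atTop 4] with n hn
  obtain ⟨t, rfl⟩ := Nat.exists_eq_add_of_le' hn
  have he := (h.mul_excess_le t).1
  have he2 := h.excess_le (t + 4)
  have hs := h.cast_succ (t + 4)
  have hp : (0 : ℝ) < m (t + 4) := mod_cast h.pos _
  have hp' : (0 : ℝ) < m (t + 4 + 1) := mod_cast h.pos _
  have hn0 : (0 : ℝ) < ((t + 4 : ℕ) : ℝ) := by positivity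
  generalize ((t + 4 : ℕ) : ℝ) = x at *
  rw [Real.dist_eq, div_sub_div _ _ hp'.ne' two_ne_zero, abs_div,
    abs_of_pos (by positivity : (0 : ℝ) < m (t + 4 + 1) * 2), div_le_div_iff₀ (by positivity) hn0]
  have : |x * m (t + 4) * 2 - m (t + 4 + 1) * 1| ≤ 5 * m (t + 4) := by
    rw [abs_le]; constructor <;> nlinarith
  nlinarith

/-- Sequences obeying a perturbation of the linear part of the recurrence of `m` grow, relative
to `m`, linearly with the rate given by the inhomogeneity. -/
lemma tendsto_of_recurrence (h : IsMapCount m) {A B T : ℕ → ℝ} {β : ℝ} (hA0 : A 0 = 0)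
    (hA : ∀ n, A (n + 1) = (2 * n + 3) * A n + T n + B n)
    (hT0 : ∀ n, 0 ≤ T n) (hT : ∀ n, T n ≤ n * excess m n)
    (hpos : ∀ n, 0 ≤ A n) (hle : ∀ n, A n ≤ 2 * (n * m n))
    (hB : Tendsto (fun n => B n / m (n + 1)) atTop (nhds β)) :
    Tendsto (fun n : ℕ => A n / (n * m n)) atTop (nhds β) := by
  have hlim : Tendsto (fun n : ℕ => (28 : ℝ) / (n : ℝ)) atTop (nhds 0) :=
    tendsto_const_div_atTop_nhds_zero_nat 28
  have hdiff : Tendsto (fun n => (A (n + 1) / m (n + 1) - A n / m n) - B n / m (n + 1))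
      atTop (nhds 0) := by
    refine squeeze_zero_norm' ?_ hlim
    filter_upwards [eventually_ge_atTop 4] with n hn
    obtain ⟨t, rfl⟩ := Nat.exists_eq_add_of_le' hn
    obtain ⟨he, hne⟩ := h.mul_excess_le t
    have hs := h.cast_succ (t + 4)
    have hp : (0 : ℝ) < m (t + 4) := mod_cast h.pos _
    have hp' : (0 : ℝ) < m (t + 4 + 1) := mod_cast h.pos _
    have hn0 : (0 : ℝ) < ((t + 4 : ℕ) : ℝ) := by positivity
    have hT0 := hT0 (t + 4)
    have hT := hT (t + 4)
    have hpos := hpos (t + 4)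
    have hle := hle (t + 4)
    have hA := hA (t + 4)
    generalize ((t + 4 : ℕ) : ℝ) = x at *
    generalize excess m (t + 4) = e at *
    generalize (m (t + 4) : ℝ) = p at *
    generalize (m (t + 4 + 1) : ℝ) = q at *
    have key : A (t + 4 + 1) / q - A (t + 4) / p - B (t + 4) / q =
        (T (t + 4) - A (t + 4) / p * e) / q := by
      field_simp
      rw [hA, hs]
      ring
    have hd0 : 0 ≤ A (t + 4) / p := by positivity
    have hd1 : A (t + 4) / p ≤ 2 * x := by
      rw [div_le_iff₀ hp]; linarith
    have habs : |T (t + 4) - A (t + 4) / p * e| ≤ 28 * p := by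
      have h1 := mul_le_mul_of_nonneg_right hd1 he
      have h2 := mul_nonneg hd0 he
      rw [abs_le]; constructor <;> linarith
    rw [key, Real.norm_eq_abs, abs_div, abs_of_pos hp', div_le_div_iff₀ hp' hn0]
    have h3 := mul_le_mul_of_nonneg_right habs hn0.le
    nlinarith [mul_pos hn0 hp]
  have hstep := hdiff.add hB
  simp only [sub_add_cancel, zero_add] at hstep
  refine hstep.cesaro.congr fun n => ?_
  rw [Finset.sum_range_sub (fun n => A n / (m n : ℝ)), hA0]
  simp only [zero_div, sub_zero]
  rw [inv_mul_eq_div, div_div, mul_comm (m n : ℝ)]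

/-- The asymptotics of the system satisfied by the total root degree `D` and the total number
of loops `L`. -/
lemma tendsto_of_system (h : IsMapCount m) {D L : ℕ → ℝ} (hD0 : D 0 = 0) (hL0 : L 0 = 0)
    (hD : ∀ n, D (n + 1) = m (n + 1) + (2 * n + 2) * D n +
      ∑ k ∈ Finset.range (n + 1), (m k : ℝ) * D (n - k))
    (hL : ∀ n, L (n + 1) = (2 * n + 1) * L n +
      2 * ∑ k ∈ Finset.range (n + 1), (m k : ℝ) * L (n - k) + D n) :
    Tendsto (fun n : ℕ => L n / (n * m n)) atTop (nhds (1 / 2)) := by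
  have hmul : ∀ n : ℕ, (2 * n + 1 : ℝ) * m n ≤ m (n + 1) := fun n => mod_cast h.le_succ n
  have hm0 : ∀ n, (0 : ℝ) ≤ m n := fun n => Nat.cast_nonneg _
  have hDpos : ∀ n, 0 ≤ D n := by
    intro n
    induction n using Nat.strong_induction_on with
    | _ n ih =>
      match n, ih with
      | 0, _ => exact hD0.ge
      | n + 1, ih =>
        have := ih n (by omega)
        rw [hD]
        exact add_nonneg (by positivity) (Finset.sum_nonneg fun k _ =>
          mul_nonneg (hm0 _) (ih _ (by omega)))
  have hDle : ∀ n, D n ≤ 2 * (n * m n) := by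
    intro n
    induction n using Nat.strong_induction_on with
    | _ n ih =>
      match n, ih with
      | 0, _ => simp [hD0]
      | n + 1, ih =>
        have h1 := ih n (by omega)
        have h2 := conv_le_of_forall_le (m := m) (f := D) (a := 2) (n := n)
          (fun k hk => ih k (by omega))
        have h3 := h.cast_succ n
        have h4 := hmul n
        have hx : (0 : ℝ) ≤ n := Nat.cast_nonneg n
        rw [hD]
        have h5 := mul_le_mul_of_nonneg_left h1 (by positivity : (0 : ℝ) ≤ 2 * n + 2)
        have h6 := mul_le_mul_of_nonneg_left h4 (by positivity : (0 : ℝ) ≤ n + 1)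
        have h7 := congrArg ((n : ℝ) * ·) h3
        push_cast
        nlinarith [hm0 n]
  have hLpos : ∀ n, 0 ≤ L n := by
    intro n
    induction n using Nat.strong_induction_on with
    | _ n ih =>
      match n, ih with
      | 0, _ => exact hL0.ge
      | n + 1, ih =>
        have h1 := ih n (by omega)
        have h2 := hDpos n
        have h3 : 0 ≤ ∑ k ∈ Finset.range (n + 1), (m k : ℝ) * L (n - k) :=
          Finset.sum_nonneg fun k _ => mul_nonneg (hm0 _) (ih _ (by omega))
        rw [hL]
        positivity
  have hLle : ∀ n, L n ≤ 1 * (n * m n) := by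
    intro n
    induction n using Nat.strong_induction_on with
    | _ n ih =>
      match n, ih with
      | 0, _ => simp [hL0]
      | n + 1, ih =>
        have h1 := ih n (by omega)
        have h2 := conv_le_of_forall_le (m := m) (f := L) (a := 1) (n := n)
          (fun k hk => ih k (by omega))
        have h3 := h.cast_succ n
        have h4 := hmul n
        have hx : (0 : ℝ) ≤ n := Nat.cast_nonneg n
        rw [hL]
        have h5 := mul_le_mul_of_nonneg_left h1 (by positivity : (0 : ℝ) ≤ 2 * n + 1)
        have h6 := hDle n
        have h7 := congrArg ((n : ℝ) * ·) h3
        push_cast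
        nlinarith [hm0 n]
  have hDlim : Tendsto (fun n : ℕ => D n / (n * m n)) atTop (nhds 1) := by
    refine h.tendsto_of_recurrence (B := fun n => m (n + 1))
      (T := fun n => ∑ k ∈ Finset.range (n + 1), (m k : ℝ) * D (n - k) - D n)
      hD0 (fun n => by rw [hD]; ring) (fun n => sub_nonneg.2 (h.le_conv hDpos n))
      (fun n => by linarith [h.conv_le hDle n]) hDpos hDle ?_
    refine tendsto_const_nhds.congr fun n => (div_self ?_).symm
    exact_mod_cast (h.pos _).ne'
  refine h.tendsto_of_recurrence (B := D)
    (T := fun n => 2 * (∑ k ∈ Finset.range (n + 1), (m k : ℝ) * L (n - k) - L n))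
    hL0 (fun n => by rw [hL]; ring)
    (fun n => mul_nonneg zero_le_two (sub_nonneg.2 (h.le_conv hLpos n)))
    (fun n => by linarith [h.conv_le hLle n]) hLpos
    (fun n => by linarith [hLle n, hLpos n]) ?_
  have hprod := hDlim.mul h.tendsto_ratio
  rw [one_mul] at hprod
  refine hprod.congr' ?_
  filter_upwards [eventually_gt_atTop 0] with n hn
  have h1 : (m n : ℝ) ≠ 0 := by exact_mod_cast (h.pos _).ne'
  have h2 : (n : ℝ) ≠ 0 := by exact_mod_cast hn.ne'
  field_simp

end IsMapCount

/-- The algebra map `p(v, w) ↦ p(1, w)`. -/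
noncomputable abbrev specializeRoot : MvPolynomial (Fin 2) ℝ →ₐ[ℝ] MvPolynomial (Fin 2) ℝ :=
  aeval (fun j : Fin 2 => if j = 0 then (1 : MvPolynomial (Fin 2) ℝ) else X 1)

lemma eval_specialize (p : MvPolynomial (Fin 2) ℝ) :
    eval (fun _ => (1 : ℝ)) (specializeRoot p) = eval (fun _ => (1 : ℝ)) p := by
  induction p using MvPolynomial.induction_on with
  | C a => simp
  | add p q hp hq => simp only [map_add, hp, hq]
  | mul_X p i hp => simp only [map_mul, hp]; fin_cases i <;> simp

lemma pderiv_zero_specialize (p : MvPolynomial (Fin 2) ℝ) :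
    pderiv 0 (specializeRoot p) = 0 := by
  induction p using MvPolynomial.induction_on with
  | C a => simp [specializeRoot]
  | add p q hp hq => simp only [map_add, hp, hq, add_zero]
  | mul_X p i hp =>
    simp only [map_mul, Derivation.leibniz, hp]
    fin_cases i <;> simp [pderiv_X]

lemma eval_pderiv_one_specialize (p : MvPolynomial (Fin 2) ℝ) :
    eval (fun _ => (1 : ℝ)) (pderiv 1 (specializeRoot p)) =
      eval (fun _ => (1 : ℝ)) (pderiv 1 p) := by
  induction p using MvPolynomial.induction_on with
  | C a => simp [specializeRoot]
  | add p q hp hq => simp only [map_add, hp, hq]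
  | mul_X p i hp =>
    simp only [map_mul, Derivation.leibniz, map_add, smul_eq_mul, hp, eval_specialize]
    fin_cases i <;> simp [pderiv_X]

end RootedMaps

open RootedMaps in
/-- The mean number of loops of a uniform random rooted map with `n`
edges is asymptotic to `n/2`: `lim_{n→∞} (∂_w y_n)(1,1)/(n·m(n)) = 1/2`. -/
theorem loops_mean
    (m : ℕ → ℕ) (hm0 : m 0 = 1)
    (hm : ∀ n : ℕ, m (n + 1) =
      (∑ k ∈ Finset.range (n + 1), m k * m (n - k)) + (2 * (n + 1) - 1) * m n)
    (y : ℕ → MvPolynomial (Fin 2) ℝ) (hy0 : y 0 = 1)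
    (hy : ∀ n : ℕ, y (n + 1) =
      X 0 * y n + C (2 * (n : ℝ)) * X 0 * y n +
        X 0 * ∑ i ∈ Finset.range (n + 1),
          (aeval (fun j : Fin 2 => if j = 0 then (1 : MvPolynomial (Fin 2) ℝ) else X 1)
              (y i)) * y (n - i) +
        X 0 ^ 2 * (X 0 * X 1 - 1) * pderiv (0 : Fin 2) (y n)) :
    Tendsto
      (fun n : ℕ =>
        eval (fun _ : Fin 2 => (1 : ℝ)) (pderiv (1 : Fin 2) (y n)) / ((n : ℝ) * (m n : ℝ)))
      atTop (nhds (1 / 2)) := by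
  have h : IsMapCount m := ⟨hm0, hm⟩
  have hM : ∀ n, eval (fun _ : Fin 2 => (1 : ℝ)) (y n) = m n := by
    intro n
    induction n using Nat.strong_induction_on with
    | _ n ih =>
      match n, ih with
      | 0, _ => simp [hy0, hm0]
      | n + 1, ih =>
        have hs : ∑ k ∈ Finset.range (n + 1), eval (fun _ : Fin 2 => (1 : ℝ)) (y k) *
            eval (fun _ : Fin 2 => (1 : ℝ)) (y (n - k)) =
            ∑ k ∈ Finset.range (n + 1), (m k : ℝ) * m (n - k) :=
          Finset.sum_congr rfl fun k hk => by
            rw [Finset.mem_range] at hk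
            rw [ih k hk, ih (n - k) (by omega)]
        rw [hy, h.succ n]
        simp only [map_add, map_mul, map_sum, eval_specialize, hs, ih n (by omega)]
        simp
        ring
  refine h.tendsto_of_system
    (D := fun n => eval (fun _ : Fin 2 => (1 : ℝ)) (pderiv (0 : Fin 2) (y n)))
    (L := fun n => eval (fun _ : Fin 2 => (1 : ℝ)) (pderiv (1 : Fin 2) (y n)))
    (by simp [hy0]) (by simp [hy0]) (fun n => ?_) (fun n => ?_)
  · simp only [hy, h.succ n, map_add, map_mul, map_sum, map_sub, map_pow, Derivation.leibniz,
      Derivation.leibniz_pow, smul_eq_mul, pderiv_zero_specialize, eval_specialize, hM]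
    simp [pderiv_X]
    ring
  · simp only [hy, map_add, map_mul, map_sum, map_sub, map_pow, Derivation.leibniz,
      Derivation.leibniz_pow, smul_eq_mul, eval_pderiv_one_specialize, eval_specialize, hM]
    have hr : ∑ k ∈ Finset.range (n + 1), (m (n - k) : ℝ) *
        eval (fun _ : Fin 2 => (1 : ℝ)) (pderiv (1 : Fin 2) (y k)) =
        ∑ k ∈ Finset.range (n + 1), (m k : ℝ) *
          eval (fun _ : Fin 2 => (1 : ℝ)) (pderiv (1 : Fin 2) (y (n - k))) := by
      rw [← Finset.sum_range_reflect]
      refine Finset.sum_congr rfl fun k hk => ?_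
      rw [Finset.mem_range] at hk
      rw [show n + 1 - 1 - k = n - k by omega, Nat.sub_sub_self (by omega)]
    simp [pderiv_X, Finset.sum_add_distrib, hr]
    ring
end
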